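/- arXiv:2407.10556 — 6 statements merged into one kernel-verified Lean document; each statement's English description precedes it below -/
import Mathlib

section
/- Let G be an equatorial graph with equator q, girth g, k = ⌈g/2⌉ − 1 and minimum degree δ, and let C = u_0, u_1, …, u_{q−1} be an isometric cycle of length q in G, with edges e_i = u_i u_{i+1} (subscripts mod q). If g is odd, then |D_k(u_i)| = M(δ, g) for every vertex u_i of C, every vertex v of G is contained in exactly g of the disks D_k(u_i), and the set of indices i with v ∈ D_k(u_i) is an interval {j−k, j−k+1, …, j+k} of 2k+1 consecutive residues mod q. If g is even, then |D_k(e_i)| = M(δ, g) for every edge e_i of C, every vertex v of G is contained in exactly g of the disks D_k(e_i), and the set of indices i with v ∈ D_k(e_i) is an interval {j−k−1, j−k, …, j+k} of 2k+2 consecutive residues mod q. -/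
open SimpleGraph

/-- The distance between two indices around a cycle of length `q`. -/
def cycleDist {q : ℕ} (i j : ZMod q) : ℕ := min (i - j).val (j - i).val

/-- `f` lists the vertices (in cyclic order) of an isometric cycle of length `q` in `G`:
the distance in `G` between any two of its vertices equals their distance along the cycle. -/
def IsIsoCycle {V : Type*} (G : SimpleGraph V) (q : ℕ) (f : ZMod q → V) : Prop :=
  3 ≤ q ∧ ∀ i j : ZMod q, G.dist (f i) (f j) = cycleDist i j

/-- `G` has an isometric cycle of length `q`. -/
def HasIsoCycle {V : Type*} (G : SimpleGraph V) (q : ℕ) : Prop :=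
  ∃ f : ZMod q → V, IsIsoCycle G q f

/-- The equator of `G` is `q`: `q` is the length of a longest isometric cycle of `G`
(`0` if `G` has no isometric cycle, e.g. if `G` is acyclic). -/
def IsEquator {V : Type*} (G : SimpleGraph V) (q : ℕ) : Prop :=
  (HasIsoCycle G q ∨ (q = 0 ∧ ∀ q', ¬ HasIsoCycle G q')) ∧ ∀ q', HasIsoCycle G q' → q' ≤ q

/-- The degree of a vertex, as the cardinality of its neighbor set. -/
noncomputable def ndeg {V : Type*} (G : SimpleGraph V) (v : V) : ℕ := (G.neighborSet v).ncard

/-- `G` has minimum degree `δ`. -/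
def HasMinDegree {V : Type*} (G : SimpleGraph V) (δ : ℕ) : Prop :=
  (∀ v, δ ≤ ndeg G v) ∧ ∃ v, ndeg G v = δ

/-- The Moore bound `M(δ, g)`. -/
def mooreBound (δ g : ℕ) : ℕ :=
  if Odd g then 1 + δ * ∑ i ∈ Finset.range ((g + 1) / 2 - 1), (δ - 1) ^ i
  else 2 + ∑ i ∈ Finset.Icc 1 ((g + 1) / 2 - 1), 2 * (δ - 1) ^ i

/-- The disk of radius `k` around a vertex `u`. -/
def disk {V : Type*} (G : SimpleGraph V) (k : ℕ) (u : V) : Set V := {v | G.dist u v ≤ k}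

/-- The disk of radius `k` around an edge `uv`. -/
def edisk {V : Type*} (G : SimpleGraph V) (k : ℕ) (u v : V) : Set V :=
  disk G k u ∪ disk G k v

/-- `G` is an equatorial graph with minimum degree `δ`, girth `g` and equator `q`:
a finite connected simple graph with girth `g`, minimum degree `δ`, equator `q > 6k + 3`
(where `k = ⌈g/2⌉ - 1`) whose order attains the bound `n = (q/g) · M(δ, g)`. -/
def IsEquatorial {V : Type*} (G : SimpleGraph V) (δ g q : ℕ) : Prop :=
  Finite V ∧ G.Connected ∧ G.girth = g ∧ HasMinDegree G δ ∧ IsEquator G q ∧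
    6 * ((g + 1) / 2 - 1) + 3 < q ∧ g * Nat.card V = q * mooreBound δ g

/-- The part `L i` of the partition induced by the isometric cycle `f`:
`L i = D_k(u_{i-k}) ∩ D_k(u_{i+k})`. -/
def Lpart {V : Type*} (G : SimpleGraph V) (k : ℕ) {q : ℕ} (f : ZMod q → V) (i : ZMod q) :
    Set V :=
  disk G k (f (i - (k : ZMod q))) ∩ disk G k (f (i + (k : ZMod q)))

theorem SimpleGraph.Walk.IsPath.eq_of_length_add_length_lt_girth {V : Type*} {G : SimpleGraph V}
    {a b : V} {p p' : G.Walk a b} (hp : p.IsPath) (hp' : p'.IsPath)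
    (h : p.length + p'.length < G.girth) : p = p' := by
  by_contra hne
  obtain ⟨w, -, -, c, hc, hle⟩ := hp.exists_isCycle_length_le_add_of_ne hp' hne
  have := girth_le_length hc
  omega

/-- Below half the girth, a vertex has at most one neighbor closer to a given vertex. -/
theorem SimpleGraph.Connected.eq_of_adj_of_dist_add_one {V : Type*} {G : SimpleGraph V}
    (hc : G.Connected) {u w x y : V} (h : 2 * G.dist u w < G.girth)
    (hx : G.Adj x w) (hy : G.Adj y w)
    (hdx : G.dist u x + 1 = G.dist u w) (hdy : G.dist u y + 1 = G.dist u w) : x = y := by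
  obtain ⟨p, hp⟩ := hc.exists_walk_length_eq_dist u x
  obtain ⟨p', hp'⟩ := hc.exists_walk_length_eq_dist u y
  have h₁ : (p.concat hx).length = G.dist u w := by rw [Walk.length_concat]; omega
  have h₂ : (p'.concat hy).length = G.dist u w := by rw [Walk.length_concat]; omega
  have heq := (Walk.isPath_of_length_eq_dist _ h₁).eq_of_length_add_length_lt_girth
    (Walk.isPath_of_length_eq_dist _ h₂) (by omega)
  simpa using congrArg Walk.penultimate heq

/-- Below half the girth, adjacent vertices are at different distances from a given vertex. -/
theorem SimpleGraph.Connected.dist_ne_dist_of_adj {V : Type*} {G : SimpleGraph V}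
    (hc : G.Connected) {u w x : V} (h : 2 * G.dist u w + 1 < G.girth) (hx : G.Adj x w) :
    G.dist u x ≠ G.dist u w := by
  classical
  intro heq
  obtain ⟨p, hp⟩ := hc.exists_walk_length_eq_dist u x
  obtain ⟨p', hp'⟩ := hc.exists_walk_length_eq_dist u w
  have hpp := Walk.isPath_of_length_eq_dist _ hp
  have hw : w ∉ p.support := by
    intro hw
    have h₁ := dist_le (p.takeUntil w hw)
    have h₂ := congrArg Walk.length (p.take_spec hw)
    rw [Walk.length_append] at h₂
    have h₃ := Walk.eq_of_length_eq_zero (p := p.dropUntil w hw) (by omega)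
    exact hx.ne h₃.symm
  have hq := (hpp.concat hw hx).eq_of_length_add_length_lt_girth
    (Walk.isPath_of_length_eq_dist _ hp') (by rw [Walk.length_concat]; omega)
  have := congrArg Walk.length hq
  rw [Walk.length_concat] at this
  omega

/-- Below half the girth, all neighbors but one of a vertex `w ≠ u` are farther from `u`. -/
theorem SimpleGraph.Connected.ndeg_le_ncard_farther_add_one {V : Type*} [Finite V]
    {G : SimpleGraph V} (hc : G.Connected) {u w : V} (h : 2 * G.dist u w + 1 < G.girth) :
    ndeg G w ≤ {x | G.Adj w x ∧ G.dist u x = G.dist u w + 1}.ncard + 1 := by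
  have hsub : G.neighborSet w ⊆ {x | G.Adj w x ∧ G.dist u x = G.dist u w + 1} ∪
      {x | G.Adj x w ∧ G.dist u x + 1 = G.dist u w} := by
    intro x hx
    have hx : G.Adj w x := hx
    have h₁ := hc.dist_ne_dist_of_adj h hx.symm
    have h₂ := hc.dist_triangle (u := u) (v := w) (w := x)
    have h₃ := hc.dist_triangle (u := u) (v := x) (w := w)
    rw [dist_eq_one_iff_adj.2 hx] at h₂
    rw [dist_eq_one_iff_adj.2 hx.symm] at h₃
    by_cases h₄ : G.dist u x = G.dist u w + 1
    · exact Or.inl ⟨hx, h₄⟩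
    · exact Or.inr ⟨hx.symm, by omega⟩
  have hone : {x | G.Adj x w ∧ G.dist u x + 1 = G.dist u w}.ncard ≤ 1 :=
    (Set.ncard_le_one_iff).2 fun ha hb =>
      hc.eq_of_adj_of_dist_add_one (by omega) ha.1 hb.1 ha.2 hb.2
  have := (Set.ncard_le_ncard hsub).trans (Set.ncard_union_le _ _)
  unfold ndeg
  omega

theorem SimpleGraph.mul_ncard_le_ncard_of_adj {V : Type*} [Finite V] {G : SimpleGraph V}
    {A B : Set V} {d : ℕ} (hA : ∀ a ∈ A, d ≤ {x | G.Adj a x ∧ x ∈ B}.ncard)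
    (hB : ∀ b ∈ B, ∀ x ∈ A, ∀ y ∈ A, G.Adj x b → G.Adj y b → x = y) :
    A.ncard * d ≤ B.ncard := by
  classical
  have := Fintype.ofFinite V
  have key := Finset.card_mul_le_card_mul (s := A.toFinset) (t := B.toFinset) (m := d) (n := 1)
    G.Adj (fun a ha => ?_) (fun b hb => ?_)
  · simpa [Set.ncard_eq_toFinset_card'] using key
  · refine (hA a (by simpa using ha)).trans_eq ?_
    rw [Set.ncard_eq_toFinset_card']
    congr 1
    ext x
    simp [Finset.bipartiteAbove, and_comm]
  · refine Finset.card_le_one.2 fun x hx y hy => ?_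
    simp only [Finset.bipartiteBelow, Finset.mem_filter, Set.mem_toFinset] at hx hy
    exact hB b (by simpa using hb) x hx.1 y hy.1 hx.2 hy.2

theorem SimpleGraph.Connected.le_ncard_sphere {V : Type*} [Finite V] {G : SimpleGraph V}
    (hc : G.Connected) {δ : ℕ} (hδ : ∀ v, δ ≤ ndeg G v) (u : V) (i : ℕ)
    (h : 2 * (i + 1) < G.girth) : δ * (δ - 1) ^ i ≤ {x | G.dist u x = i + 1}.ncard := by
  induction i with
  | zero =>
    have : {x | G.dist u x = 0 + 1} = G.neighborSet u := by
      ext x; simp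
    rw [this]
    simpa [ndeg] using hδ u
  | succ i ih =>
    have key := mul_ncard_le_ncard_of_adj (G := G) (A := {x | G.dist u x = i + 1})
      (B := {x | G.dist u x = i + 1 + 1}) (d := δ - 1) ?_ ?_
    · calc δ * (δ - 1) ^ (i + 1) = δ * (δ - 1) ^ i * (δ - 1) := by ring
        _ ≤ _ := Nat.mul_le_mul_right _ (ih (by omega))
        _ ≤ _ := key
    · intro a (ha : G.dist u a = i + 1)
      have := hc.ndeg_le_ncard_farther_add_one (u := u) (w := a) (by omega)
      have := hδ a
      rw [ha] at *
      simp only [Set.mem_ofPred_eq]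
      omega
    · intro b (hb : G.dist u b = _) x (hx : G.dist u x = _) y (hy : G.dist u y = _) hxb hyb
      exact hc.eq_of_adj_of_dist_add_one (u := u) (by omega) hxb hyb (by omega) (by omega)

/-- The Moore bound for disks around a vertex. -/
theorem SimpleGraph.Connected.le_ncard_disk {V : Type*} [Finite V] {G : SimpleGraph V}
    (hc : G.Connected) {δ : ℕ} (hδ : ∀ v, δ ≤ ndeg G v) (u : V) (r : ℕ)
    (h : 2 * r < G.girth) :
    1 + δ * ∑ i ∈ Finset.range r, (δ - 1) ^ i ≤ (disk G r u).ncard := by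
  induction r with
  | zero =>
    have : (disk G 0 u).Nonempty := ⟨u, by simp [disk]⟩
    have := (Set.ncard_pos).2 this
    simp only [Finset.range_zero, Finset.sum_empty, mul_zero]
    omega
  | succ r ih =>
    have hU : disk G (r + 1) u = disk G r u ∪ {x | G.dist u x = r + 1} := by
      ext x; simp only [disk, Set.mem_union, Set.mem_ofPred_eq]; omega
    have hd : Disjoint (disk G r u) {x | G.dist u x = r + 1} := by
      rw [Set.disjoint_left]
      intro x hx (hx' : G.dist u x = r + 1)
      have : G.dist u x ≤ r := hx
      omega
    rw [hU, Set.ncard_union_eq hd, Finset.sum_range_succ, mul_add]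
    have := ih (by omega)
    have := hc.le_ncard_sphere hδ u r h
    omega

theorem SimpleGraph.Connected.le_ncard_half_sphere {V : Type*} [Finite V] {G : SimpleGraph V}
    (hc : G.Connected) {δ : ℕ} (hδ : ∀ v, δ ≤ ndeg G v) {u v : V} (huv : G.Adj u v) (i : ℕ)
    (h : 2 * i + 1 < G.girth) :
    (δ - 1) ^ i ≤ {x | G.dist u x = i ∧ G.dist v x = i + 1}.ncard := by
  induction i with
  | zero =>
    have : {x | G.dist u x = 0 ∧ G.dist v x = 0 + 1}.Nonempty := ⟨u, by simp [huv.symm]⟩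
    have := (Set.ncard_pos).2 this
    rw [pow_zero]
    omega
  | succ i ih =>
    have key := mul_ncard_le_ncard_of_adj (G := G)
      (A := {x | G.dist u x = i ∧ G.dist v x = i + 1})
      (B := {x | G.dist u x = i + 1 ∧ G.dist v x = i + 1 + 1}) (d := δ - 1) ?_ ?_
    · exact (Nat.mul_le_mul_right _ (ih (by omega))).trans key
    · rintro a ⟨ha, ha'⟩
      have h₁ := hc.ndeg_le_ncard_farther_add_one (u := v) (w := a) (by omega)
      have h₂ := hδ a
      have hsub : {x | G.Adj a x ∧ G.dist v x = G.dist v a + 1} ⊆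
          {x | G.Adj a x ∧ x ∈ {x | G.dist u x = i + 1 ∧ G.dist v x = i + 1 + 1}} := by
        rintro x ⟨hax, hx⟩
        have h₃ := hc.dist_triangle (u := u) (v := a) (w := x)
        have h₄ := hc.dist_triangle (u := v) (v := u) (w := x)
        rw [dist_eq_one_iff_adj.2 hax] at h₃
        rw [dist_eq_one_iff_adj.2 huv.symm] at h₄
        exact ⟨hax, by omega, by omega⟩
      have := Set.ncard_le_ncard hsub
      omega
    · rintro b ⟨hb, -⟩ x ⟨hx, -⟩ y ⟨hy, -⟩ hxb hyb
      exact hc.eq_of_adj_of_dist_add_one (u := u) (by omega) hxb hyb (by omega) (by omega)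

/-- The Moore bound for disks around an edge. -/
theorem SimpleGraph.Connected.le_ncard_edisk {V : Type*} [Finite V] {G : SimpleGraph V}
    (hc : G.Connected) {δ : ℕ} (hδ : ∀ v, δ ≤ ndeg G v) {u v : V} (huv : G.Adj u v) (r : ℕ)
    (h : 2 * r + 1 < G.girth) :
    2 + ∑ i ∈ Finset.Icc 1 r, 2 * (δ - 1) ^ i ≤ (edisk G r u v).ncard := by
  induction r with
  | zero =>
    have hsub : {u, v} ⊆ edisk G 0 u v := by
      rintro x (rfl | rfl) <;> simp [edisk, disk]
    simpa [Set.ncard_pair huv.ne] using Set.ncard_le_ncard hsub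
  | succ r ih =>
    set A := {x | G.dist u x = r + 1 ∧ G.dist v x = r + 1 + 1}
    set B := {x | G.dist v x = r + 1 ∧ G.dist u x = r + 1 + 1}
    have hU : edisk G r u v ∪ (A ∪ B) ⊆ edisk G (r + 1) u v := by
      intro x
      simp only [A, B, edisk, disk, Set.mem_union, Set.mem_ofPred_eq]
      omega
    have hAB : Disjoint A B := by
      rw [Set.disjoint_left]
      rintro x ⟨h₁, h₂⟩ ⟨h₃, h₄⟩
      omega
    have hd : Disjoint (edisk G r u v) (A ∪ B) := by
      rw [Set.disjoint_left]
      intro x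
      simp only [A, B, edisk, disk, Set.mem_union, Set.mem_ofPred_eq]
      omega
    have hle := Set.ncard_le_ncard hU
    rw [Set.ncard_union_eq hd, Set.ncard_union_eq hAB] at hle
    rw [Finset.sum_Icc_succ_top (by omega)]
    have := ih (by omega)
    have hA : _ ≤ A.ncard := hc.le_ncard_half_sphere hδ huv (r + 1) h
    have hB : _ ≤ B.ncard := hc.le_ncard_half_sphere hδ huv.symm (r + 1) h
    omega

/-- Residues that are pairwise close around a long cycle lie on a short arc. -/
theorem exists_subset_arc_of_cycleDist_le {q d : ℕ} (hq : 3 * d < q) (J : Set (ZMod q))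
    (hJ : ∀ i ∈ J, ∀ j ∈ J, cycleDist i j ≤ d) :
    ∃ a : ZMod q, ∀ i ∈ J, ∃ m : ℕ, m ≤ d ∧ i = a + m := by
  have : NeZero q := ⟨by omega⟩
  rcases J.eq_empty_or_nonempty with rfl | ⟨i₀, hi₀⟩
  · exact ⟨0, by simp⟩
  have hval : ∀ j ∈ J, (j - i₀ + d).val ≤ 2 * d := by
    intro j hj
    have hdist := hJ j hj i₀ hi₀
    rw [cycleDist, min_le_iff] at hdist
    have hd : (d : ZMod q).val = d := ZMod.val_cast_of_lt (by omega)
    rcases hdist with hdist | hdist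
    · have := ZMod.val_add_le (j - i₀) (d : ZMod q)
      omega
    · have : j - i₀ + d = ((d - (i₀ - j).val : ℕ) : ZMod q) := by
        rw [Nat.cast_sub hdist, ZMod.natCast_zmod_val]; ring
      rw [this, ZMod.val_cast_of_lt (by omega)]
      omega
  obtain ⟨a, ha, hmin⟩ := J.toFinite.exists_minimalFor (fun j => (j - i₀ + d).val) J ⟨i₀, hi₀⟩
  refine ⟨a, fun i hi => ⟨(i - a).val, ?_, by simp⟩⟩
  have hle : (a - i₀ + d).val ≤ (i - i₀ + d).val := by
    rcases le_total (a - i₀ + d).val (i - i₀ + d).val with h | h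
    · exact h
    · exact hmin hi h
  have hsub : (i - a).val = (i - i₀ + d).val - (a - i₀ + d).val := by
    rw [← ZMod.val_sub hle]; congr 1; ring
  have hdist := hJ i hi a ha
  rw [cycleDist, min_le_iff] at hdist
  rcases hdist with hdist | hdist
  · exact hdist
  · have h₁ := hval i hi
    have h₂ : (i - a).val + (a - i).val = q ∨ (i - a).val = 0 := by
      by_cases h0 : i - a = 0
      · exact Or.inr (by simp [h0])
      · left
        have : NeZero (i - a) := ⟨h0⟩
        have := ZMod.val_neg_of_ne_zero (i - a)
        have := ZMod.val_lt (i - a)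
        rw [neg_sub] at *
        omega
    omega

open Classical in
theorem Set.ncard_eq_sum_ite {α : Type*} [Fintype α] (S : Set α) :
    S.ncard = ∑ a, if a ∈ S then 1 else 0 := by
  rw [Set.ncard_eq_toFinset_card', ← Finset.card_filter]
  congr 1
  ext
  simp

theorem eq_of_double_counting {ι V : Type*} [Finite ι] [Finite V] (D : ι → Set V) {M g : ℕ}
    (hM : ∀ i, M ≤ (D i).ncard) (hg : ∀ v, {i | v ∈ D i}.ncard ≤ g)
    (h : g * Nat.card V = Nat.card ι * M) :
    (∀ i, (D i).ncard = M) ∧ ∀ v, {i | v ∈ D i}.ncard = g := by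
  classical
  have := Fintype.ofFinite V
  have := Fintype.ofFinite ι
  have hcount : ∑ i, (D i).ncard = ∑ v, {i | v ∈ D i}.ncard := by
    simp_rw [Set.ncard_eq_sum_ite, Set.mem_ofPred_eq]
    exact Finset.sum_comm
  have h₁ : ∑ _i : ι, M ≤ ∑ i, (D i).ncard := Finset.sum_le_sum fun i _ => hM i
  have h₂ : ∑ v, {i | v ∈ D i}.ncard ≤ ∑ _v : V, g := Finset.sum_le_sum fun v _ => hg v
  have h₃ : ∑ _i : ι, M = ∑ _v : V, g := by
    simp only [Finset.sum_const, Finset.card_univ, smul_eq_mul, ← Nat.card_eq_fintype_card]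
    rw [← h, mul_comm]
  constructor
  · intro i
    exact ((Finset.sum_eq_sum_iff_of_le fun i _ => hM i).1 (by omega) i (Finset.mem_univ i)).symm
  · intro v
    exact (Finset.sum_eq_sum_iff_of_le fun v _ => hg v).1 (by omega) v (Finset.mem_univ v)

theorem ncard_arc_le {q : ℕ} (b : ZMod q) (n : ℕ) :
    {i : ZMod q | ∃ m : ℕ, m ≤ n ∧ i = b + m}.ncard ≤ n + 1 := by
  classical
  have : {i : ZMod q | ∃ m : ℕ, m ≤ n ∧ i = b + m} =
      ((Finset.range (n + 1)).image fun m : ℕ => b + (m : ZMod q) : Finset (ZMod q)) := by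
    ext i
    simp [eq_comm]
  rw [this, Set.ncard_coe_finset]
  exact Finset.card_image_le.trans (by simp)

/-- A family of disks in which the index sets lie on arcs with `g` elements meets the counting
bound with equality only if all index sets are arcs. -/
theorem ncard_eq_and_arc_of_double_counting {V : Type*} [Finite V] {q g M n : ℕ} [NeZero q]
    (D : ZMod q → Set V) (hn : g = n + 1) (hM : ∀ i, M ≤ (D i).ncard)
    (harc : ∀ v, ∃ b : ZMod q, ∀ i, v ∈ D i → ∃ m : ℕ, m ≤ n ∧ i = b + m)
    (h : g * Nat.card V = q * M) :
    (∀ i, (D i).ncard = M) ∧ ∀ v, {i | v ∈ D i}.ncard = g ∧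
      ∃ b : ZMod q, {i | v ∈ D i} = {i | ∃ m : ℕ, m ≤ n ∧ i = b + m} := by
  have hle : ∀ v, {i | v ∈ D i}.ncard ≤ g := by
    intro v
    obtain ⟨b, hb⟩ := harc v
    exact hn ▸ (Set.ncard_le_ncard hb).trans (ncard_arc_le b n)
  obtain ⟨h₁, h₂⟩ := eq_of_double_counting D hM hle (by rwa [Nat.card_zmod])
  refine ⟨h₁, fun v => ⟨h₂ v, ?_⟩⟩
  obtain ⟨b, hb⟩ := harc v
  exact ⟨b, Set.eq_of_subset_of_ncard_le hb (by rw [h₂ v, hn]; exact ncard_arc_le b n)⟩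

theorem IsIsoCycle.adj {V : Type*} {G : SimpleGraph V} {q : ℕ} {f : ZMod q → V}
    (hf : IsIsoCycle G q f) (i : ZMod q) : G.Adj (f i) (f (i + 1)) := by
  have : Fact (1 < q) := ⟨by have := hf.1; omega⟩
  have h₁ : ((1 : ZMod q)).val = 1 := ZMod.val_one q
  have h₂ : (-1 : ZMod q).val = q - 1 := by rw [ZMod.neg_val]; simp [h₁]
  have := hf.1
  rw [← dist_eq_one_iff_adj, hf.2, cycleDist, sub_add_cancel_left, add_sub_cancel_left, h₁, h₂]
  omega

/-- The vertices of a long isometric cycle within distance `k` of a vertex lie on an arc. -/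
theorem IsIsoCycle.exists_arc {V : Type*} {G : SimpleGraph V} {q k : ℕ} {f : ZMod q → V}
    (hf : IsIsoCycle G q f) (hc : G.Connected) (hq : 6 * k < q) (v : V) :
    ∃ a : ZMod q, ∀ i, v ∈ disk G k (f i) → ∃ m : ℕ, m ≤ 2 * k ∧ i = a + m := by
  refine exists_subset_arc_of_cycleDist_le (by omega) {i | v ∈ disk G k (f i)} ?_
  intro i (hi : G.dist (f i) v ≤ k) j (hj : G.dist (f j) v ≤ k)
  rw [← hf.2]
  have := hc.dist_triangle (u := f i) (v := v) (w := f j)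
  rw [dist_comm (u := v)] at this
  omega

/-- Lemma 5.1: in an equatorial graph, each disk around a vertex/edge of an isometric
`q`-cycle has exactly `M(δ,g)` vertices, and every vertex lies in exactly `g` such disks,
whose indices form an interval of consecutive residues mod `q`. -/
theorem stmt_6 {V : Type*} (G : SimpleGraph V) (δ g q k : ℕ)
    (hG : IsEquatorial G δ g q) (hk : k = (g + 1) / 2 - 1)
    (f : ZMod q → V) (hf : IsIsoCycle G q f) :
    (Odd g →
      (∀ i : ZMod q, (disk G k (f i)).ncard = mooreBound δ g) ∧
      (∀ v : V, ({i : ZMod q | v ∈ disk G k (f i)}).ncard = g ∧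
        ∃ j : ZMod q, {i : ZMod q | v ∈ disk G k (f i)} =
          {i : ZMod q | ∃ m : ℕ, m ≤ 2 * k ∧ i = j - (k : ZMod q) + (m : ZMod q)})) ∧
    (Even g →
      (∀ i : ZMod q, (edisk G k (f i) (f (i + 1))).ncard = mooreBound δ g) ∧
      (∀ v : V, ({i : ZMod q | v ∈ edisk G k (f i) (f (i + 1))}).ncard = g ∧
        ∃ j : ZMod q, {i : ZMod q | v ∈ edisk G k (f i) (f (i + 1))} =
          {i : ZMod q | ∃ m : ℕ, m ≤ 2 * k + 1 ∧
            i = j - (k : ZMod q) - 1 + (m : ZMod q)})) := by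
  obtain ⟨hfin, hc, hg, ⟨hδ, -⟩, -, hq, hcard⟩ := hG
  rw [← hk] at hq
  have : NeZero q := ⟨by omega⟩
  constructor
  · intro hodd
    have hgk : g = 2 * k + 1 := by obtain ⟨r, rfl⟩ := hodd; omega
    have hM : ∀ i, mooreBound δ g ≤ (disk G k (f i)).ncard := by
      intro i
      rw [mooreBound, if_pos hodd, ← hk]
      exact hc.le_ncard_disk hδ _ _ (by omega)
    obtain ⟨h₁, h₂⟩ := ncard_eq_and_arc_of_double_counting (fun i => disk G k (f i)) hgk hM
      (hf.exists_arc hc (by omega)) hcard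
    refine ⟨h₁, fun v => ⟨(h₂ v).1, ?_⟩⟩
    obtain ⟨b, hb⟩ := (h₂ v).2
    exact ⟨b + k, by simpa using hb⟩
  · intro heven
    have hg0 : g ≠ 0 := by
      rintro rfl
      have : q = 0 := by simpa [mooreBound] using hcard
      omega
    have hgk : g = 2 * k + 1 + 1 := by obtain ⟨r, rfl⟩ := heven; omega
    have hM : ∀ i, mooreBound δ g ≤ (edisk G k (f i) (f (i + 1))).ncard := by
      intro i
      rw [mooreBound, if_neg (Nat.not_odd_iff_even.2 heven), ← hk]
      exact hc.le_ncard_edisk hδ (hf.adj i) _ (by omega)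
    have harc : ∀ v, ∃ b : ZMod q, ∀ i, v ∈ edisk G k (f i) (f (i + 1)) →
        ∃ m : ℕ, m ≤ 2 * k + 1 ∧ i = b + m := by
      intro v
      obtain ⟨a, ha⟩ := hf.exists_arc hc (k := k) (by omega) v
      refine ⟨a - 1, fun i hi => ?_⟩
      rcases hi with hi | hi
      · obtain ⟨m, hm, rfl⟩ := ha i hi
        exact ⟨m + 1, by omega, by push_cast; ring⟩
      · obtain ⟨m, hm, h⟩ := ha _ hi
        exact ⟨m, by omega, by rw [sub_add_eq_add_sub, ← h, add_sub_cancel_right]⟩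
    obtain ⟨h₁, h₂⟩ := ncard_eq_and_arc_of_double_counting
      (fun i => edisk G k (f i) (f (i + 1))) hgk hM harc hcard
    refine ⟨h₁, fun v => ⟨(h₂ v).1, ?_⟩⟩
    obtain ⟨b, hb⟩ := (h₂ v).2
    refine ⟨b + k + 1, ?_⟩
    rw [show b + k + 1 - k - 1 = b by ring]
    exact hb
end

section
/- Let G be an equatorial graph with even girth g = 2k + 2, let C = u_0, …, u_{q−1} be an isometric cycle of maximum length q in G with edges e_i = u_i u_{i+1} (subscripts mod q), and let L_i be the parts of the partition induced by C. Then for every i, L_i = D_k(e_{i−k−1}) ∩ D_k(e_{i+k}). -/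
open SimpleGraph

/-- Vertices `n` steps apart on a cycle of length `q` are at distance at least `m` along it
whenever `m ≤ n` and `m ≤ q - n`. -/
theorem le_cycleDist_add_natCast {q n m : ℕ} (hm : m ≤ n) (hn : n + m ≤ q) (hq : n < q)
    (a : ZMod q) : m ≤ cycleDist a (a + (n : ZMod q)) := by
  have : NeZero q := ⟨by omega⟩
  have hval : (n : ZMod q).val = n := ZMod.val_natCast_of_lt hq
  have hneg := ZMod.neg_val (n : ZMod q)
  unfold cycleDist
  rw [sub_add_cancel_left, add_sub_cancel_left, hneg, hval]
  split_ifs with h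
  · rw [h, ZMod.val_zero] at hval
    omega
  · omega

/-- A vertex at distance at most `k` from two vertices of an isometric cycle forces these to be
at distance at most `2 * k` along the cycle. -/
theorem IsIsoCycle.cycleDist_le_of_mem_disk {V : Type*} {G : SimpleGraph V} {q k : ℕ}
    {f : ZMod q → V} (hf : IsIsoCycle G q f) (hG : G.Connected) {a b : ZMod q} {v : V}
    (ha : v ∈ disk G k (f a)) (hb : v ∈ disk G k (f b)) : cycleDist a b ≤ 2 * k := by
  have htri := hG.dist_triangle (u := f a) (v := v) (w := f b)
  rw [hf.2, G.dist_comm (u := v)] at htri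
  simp only [disk, Set.mem_ofPred_eq] at ha hb
  omega

/-- Lemma 5.2: for even girth `g = 2k + 2`, the part `L i` equals
`D_k(e_{i-k-1}) ∩ D_k(e_{i+k})`. -/
theorem stmt_7 {V : Type*} (G : SimpleGraph V) (δ q k : ℕ)
    (hG : IsEquatorial G δ (2 * k + 2) q)
    (f : ZMod q → V) (hf : IsIsoCycle G q f) :
    ∀ i : ZMod q, Lpart G k f i =
      edisk G k (f (i - (k : ZMod q) - 1)) (f (i - (k : ZMod q))) ∩
      edisk G k (f (i + (k : ZMod q))) (f (i + (k : ZMod q) + 1)) := by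
  obtain ⟨-, hconn, -, -, -, hq, -⟩ := hG
  intro i
  have far (a b : ZMod q) (n : ℕ) (h₁ : 2 * k + 1 ≤ n) (h₂ : n ≤ 2 * k + 2)
      (hab : b = a + (n : ZMod q)) {v : V} (ha : v ∈ disk G k (f a))
      (hb : v ∈ disk G k (f b)) : False := by
    have hle := hf.cycleDist_le_of_mem_disk hconn ha hb
    have hge := le_cycleDist_add_natCast (q := q) h₁ (by omega) (by omega) a
    rw [hab] at hle
    omega
  refine Set.Subset.antisymm (fun v hv => ⟨Or.inr hv.1, Or.inl hv.2⟩) ?_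
  rintro v ⟨h₁ | h₁, h₂ | h₂⟩
  · exact (far _ _ (2 * k + 1) le_rfl (by omega) (by push_cast; ring) h₁ h₂).elim
  · exact (far _ _ (2 * k + 2) (by omega) le_rfl (by push_cast; ring) h₁ h₂).elim
  · exact ⟨h₁, h₂⟩
  · exact (far _ _ (2 * k + 1) le_rfl (by omega) (by push_cast; ring) h₁ h₂).elim
end

section
/- Let G = (V, E) be an equatorial graph and let C = u_0, …, u_{q−1} be an isometric cycle of maximum length q in G. Then the sets L_i = D_k(u_{i−k}) ∩ D_k(u_{i+k}) for i ∈ [0, q−1] form a partition of V (every vertex lies in exactly one L_i), and u_i ∈ L_i for every i. -/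
open SimpleGraph

/-- The distance from `w` to the nearest of `u` and `v`. -/
noncomputable def edgeLevel {V : Type*} (G : SimpleGraph V) (u v w : V) : ℕ :=
  min (G.dist u w) (G.dist v w)

section Level

variable {V : Type*} {G : SimpleGraph V} {u v : V}

lemma edgeLevel_eq_zero_iff (hc : G.Connected) {w : V} :
    edgeLevel G u v w = 0 ↔ w = u ∨ w = v := by
  unfold edgeLevel
  rw [Nat.min_eq_zero_iff, hc.dist_eq_zero_iff, hc.dist_eq_zero_iff, eq_comm, @eq_comm _ v]

lemma edgeLevel_le_succ_of_adj (hc : G.Connected) {x y : V} (h : G.Adj x y) :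
    edgeLevel G u v y ≤ edgeLevel G u v x + 1 := by
  have h1 : G.dist x y = 1 := dist_eq_one_iff_adj.2 h
  have h2 := hc.dist_triangle (u := u) (v := x) (w := y)
  have h3 := hc.dist_triangle (u := v) (v := x) (w := y)
  unfold edgeLevel
  omega

/-- A shortest walk from `a` to the nearest of `u` and `v` has strictly smaller levels after `a`. -/
lemma exists_walk_edgeLevel (hc : G.Connected) (a : V) :
    ∃ r, (r = u ∨ r = v) ∧ ∃ p : G.Walk a r, p.length = edgeLevel G u v a ∧
      ∀ x ∈ p.support, x ≠ a → edgeLevel G u v x < edgeLevel G u v a := by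
  classical
  obtain ⟨r, hr, hra, hrx⟩ : ∃ r, (r = u ∨ r = v) ∧ G.dist a r = edgeLevel G u v a ∧
      ∀ x, edgeLevel G u v x ≤ G.dist x r := by
    simp only [edgeLevel]
    rcases le_total (G.dist u a) (G.dist v a) with h | h
    · exact ⟨u, .inl rfl, by rw [dist_comm, min_eq_left h],
        fun x => by rw [G.dist_comm (u := x)]; exact min_le_left _ _⟩
    · exact ⟨v, .inr rfl, by rw [dist_comm, min_eq_right h],
        fun x => by rw [G.dist_comm (u := x)]; exact min_le_right _ _⟩
  obtain ⟨p, hp⟩ := hc.exists_walk_length_eq_dist a r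
  refine ⟨r, hr, p, hp.trans hra, fun x hx hxa => ?_⟩
  have hlen := congrArg Walk.length (p.take_spec hx)
  rw [Walk.length_append] at hlen
  have hpos : 0 < (p.takeUntil x hx).length := by
    rw [Nat.pos_iff_ne_zero]
    exact fun h => hxa (Walk.eq_of_length_eq_zero h).symm
  have := G.dist_le (p.dropUntil x hx)
  have := hrx x
  omega

lemma exists_adj_edgeLevel_lt (hc : G.Connected) {a : V} (ha : 0 < edgeLevel G u v a) :
    ∃ b, G.Adj a b ∧ edgeLevel G u v b < edgeLevel G u v a := by
  obtain ⟨r, -, p, hp, hx⟩ := exists_walk_edgeLevel (u := u) (v := v) hc a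
  cases p with
  | nil => simp at hp; omega
  | cons h p => exact ⟨_, h, hx _ (by simp) h.ne'⟩

/-- A walk avoiding `w` between two neighbours of `w` closes up to a cycle. -/
lemma girth_le_of_walk_avoiding {w a b : V} (ha : G.Adj w a) (hb : G.Adj w b) (hab : a ≠ b)
    (p : G.Walk a b) (hp : w ∉ p.support) : G.girth ≤ p.length + 2 := by
  classical
  have hw : w ∉ p.bypass.support := fun h => hp (p.support_bypass_subset_support h)
  have hpath : (p.bypass.concat hb.symm).IsPath := p.bypass_isPath.concat hw hb.symm
  have hcyc := Path.cons_isCycle ⟨_, hpath⟩ ha (by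
    simp only [Walk.edges_concat, List.concat_eq_append, List.mem_append, List.mem_singleton,
      not_or]
    refine ⟨fun h => hw (Walk.fst_mem_support_of_mem_edges _ h), fun h => ?_⟩
    rw [Sym2.eq_iff] at h
    rcases h with ⟨h, -⟩ | ⟨-, h⟩
    · exact hb.ne h
    · exact hab h)
  have h1 := girth_le_length hcyc
  have h2 := p.length_bypass_le_length
  simp only [Walk.length_cons, Walk.length_concat] at h1
  omega

/-- Two neighbours of `w` that are no further from `{u, v}` than `w` yield a short cycle. -/
lemma girth_le_of_adj_adj (hc : G.Connected) (huv : G.dist u v ≤ 1) {w a b : V}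
    (hw : 0 < edgeLevel G u v w) (ha : G.Adj w a) (hb : G.Adj w b) (hab : a ≠ b)
    (hla : edgeLevel G u v a ≤ edgeLevel G u v w) (hlb : edgeLevel G u v b ≤ edgeLevel G u v w) :
    G.girth ≤ edgeLevel G u v a + edgeLevel G u v b + 2 + G.dist u v := by
  obtain ⟨r, hr, p, hp, hpx⟩ := exists_walk_edgeLevel (u := u) (v := v) hc a
  obtain ⟨s, hs, t, ht, htx⟩ := exists_walk_edgeLevel (u := u) (v := v) hc b
  obtain ⟨m, hm, hmx⟩ : ∃ m : G.Walk r s, m.length ≤ G.dist u v ∧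
      ∀ x ∈ m.support, edgeLevel G u v x = 0 := by
    have hr0 := (edgeLevel_eq_zero_iff hc).2 hr
    have hs0 := (edgeLevel_eq_zero_iff hc).2 hs
    by_cases hrs : r = s
    · subst hrs
      exact ⟨.nil, by simp, by simpa using hr0⟩
    · have hd : G.dist r s = G.dist u v := by
        rcases hr with rfl | rfl <;> rcases hs with rfl | rfl
        · exact absurd rfl hrs
        · rfl
        · exact dist_comm
        · exact absurd rfl hrs
      have h1 := hc.pos_dist_of_ne hrs
      have hadj : G.Adj r s := dist_eq_one_iff_adj.1 (by omega)
      refine ⟨hadj.toWalk, by simp; omega, ?_⟩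
      simp [hr0, hs0]
  have havoid : w ∉ ((p.append m).append t.reverse).support := by
    simp only [Walk.mem_support_append_iff, Walk.support_reverse, List.mem_reverse, not_or]
    refine ⟨⟨fun h => ?_, fun h => ?_⟩, fun h => ?_⟩
    · exact absurd (hpx w h ha.ne) (by omega)
    · have := hmx w h
      omega
    · exact absurd (htx w h hb.ne) (by omega)
  have := girth_le_of_walk_avoiding ha hb hab _ havoid
  simp only [Walk.length_append, Walk.length_reverse] at this
  omega

/-- Below the girth, a vertex has at most one neighbour that is not on the next level. -/
lemma eq_of_adj_of_edgeLevel_le (hc : G.Connected) (huv : G.dist u v ≤ 1) {w a b : V}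
    (hg : 2 * edgeLevel G u v w + 1 + G.dist u v < G.girth) (ha : G.Adj w a) (hb : G.Adj w b)
    (hla : edgeLevel G u v a ≤ edgeLevel G u v w)
    (hlb : edgeLevel G u v b ≤ edgeLevel G u v w) : a = b := by
  rcases Nat.eq_zero_or_pos (edgeLevel G u v w) with h0 | hpos
  · have ha' := ha.ne
    have hb' := hb.ne
    rw [h0, Nat.le_zero, edgeLevel_eq_zero_iff hc] at hla hlb
    rw [edgeLevel_eq_zero_iff hc] at h0
    grind
  · obtain ⟨c, hwc, hlc⟩ := exists_adj_edgeLevel_lt hc hpos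
    have key : ∀ x, G.Adj w x → edgeLevel G u v x ≤ edgeLevel G u v w → x = c := by
      intro x hx hlx
      by_contra hne
      have := girth_le_of_adj_adj hc huv hpos hx hwc hne hlx hlc.le
      omega
    rw [key a ha hla, key b hb hlb]

variable [Fintype V]

open Classical in
lemma card_level_mul_le (hc : G.Connected) (huv : G.dist u v ≤ 1) {δ i : ℕ}
    (hδ : ∀ w, δ ≤ ndeg G w) (hg : 2 * i + 2 + G.dist u v < G.girth) :
    (Finset.univ.filter fun w => edgeLevel G u v w = i).card * (δ - 1) ≤
      (Finset.univ.filter fun w => edgeLevel G u v w = i + 1).card := by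
  rw [← mul_one (Finset.card (Finset.univ.filter fun w => edgeLevel G u v w = i + 1))]
  refine Finset.card_mul_le_card_mul G.Adj (fun a ha => ?_) (fun b hb => ?_)
  · simp only [Finset.mem_filter, Finset.mem_univ, true_and] at ha
    have hsplit := Finset.card_filter_add_card_filter_not (s := G.neighborFinset a)
      (fun w => edgeLevel G u v w ≤ i)
    have hone : ((G.neighborFinset a).filter fun w => edgeLevel G u v w ≤ i).card ≤ 1 := by
      rw [Finset.card_le_one]
      intro x hx y hy
      simp only [Finset.mem_filter, mem_neighborFinset] at hx hy
      exact eq_of_adj_of_edgeLevel_le hc huv (by omega) hx.1 hy.1 (by omega) (by omega)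
    have hsub : ((G.neighborFinset a).filter fun w => ¬ edgeLevel G u v w ≤ i) ⊆
        (Finset.univ.filter fun w => edgeLevel G u v w = i + 1).bipartiteAbove G.Adj a := by
      intro x hx
      simp only [Finset.mem_filter, mem_neighborFinset, Finset.mem_bipartiteAbove,
        Finset.mem_univ, true_and] at hx ⊢
      have := edgeLevel_le_succ_of_adj (u := u) (v := v) hc hx.1
      exact ⟨by omega, hx.1⟩
    have hle := Finset.card_le_card hsub
    have hdeg := hδ a
    rw [ndeg, Set.ncard_eq_toFinset_card', ← neighborFinset_def] at hdeg
    omega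
  · simp only [Finset.mem_filter, Finset.mem_univ, true_and] at hb
    rw [Finset.card_le_one]
    intro x hx y hy
    simp only [Finset.mem_filter, Finset.mem_bipartiteBelow, Finset.mem_univ, true_and] at hx hy
    by_contra hne
    have := girth_le_of_adj_adj hc huv (by omega) hx.2.symm hy.2.symm hne (by omega) (by omega)
    omega

open Classical in
lemma card_level_mul_pow_le (hc : G.Connected) (huv : G.dist u v ≤ 1) {δ : ℕ}
    (hδ : ∀ w, δ ≤ ndeg G w) (j i : ℕ) (hg : 2 * (j + i) + G.dist u v < G.girth) :
    (Finset.univ.filter fun w => edgeLevel G u v w = j).card * (δ - 1) ^ i ≤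
      (Finset.univ.filter fun w => edgeLevel G u v w = j + i).card := by
  induction i with
  | zero => simp
  | succ i ih =>
    rw [pow_succ, ← mul_assoc]
    exact (Nat.mul_le_mul_right _ (ih (by omega))).trans
      (card_level_mul_le hc huv hδ (by omega))

open Classical in
lemma card_level_le_eq_sum (k : ℕ) :
    (Finset.univ.filter fun w => edgeLevel G u v w ≤ k).card =
      ∑ i ∈ Finset.range (k + 1), (Finset.univ.filter fun w => edgeLevel G u v w = i).card := by
  rw [Finset.card_eq_sum_card_fiberwise (f := edgeLevel G u v) (t := Finset.range (k + 1))]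
  · refine Finset.sum_congr rfl fun i hi => ?_
    rw [Finset.filter_filter]
    congr 1
    ext w
    simp only [Finset.mem_range] at hi
    simp only [Finset.mem_filter, Finset.mem_univ, true_and]
    omega
  · intro w hw
    simp only [Finset.coe_filter, Finset.mem_univ, true_and, Set.mem_ofPred_eq] at hw
    simp only [Finset.coe_range, Set.mem_Iio]
    omega

open Classical in
/-- The Moore bound for disks around a vertex (odd girth) or around an edge (even girth). -/
lemma mooreBound_le_card_level_le (hc : G.Connected) {δ g k : ℕ} (hgirth : G.girth = g)
    (hδ : ∀ w, δ ≤ ndeg G w) (huv : G.dist u v ≤ 1) (hg : g = 2 * k + 1 + G.dist u v) :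
    mooreBound δ g ≤ (Finset.univ.filter fun w => edgeLevel G u v w ≤ k).card := by
  have hk : (g + 1) / 2 - 1 = k := by omega
  rw [card_level_le_eq_sum, mooreBound, hk, Finset.sum_range_succ']
  rcases Nat.le_one_iff_eq_zero_or_eq_one.1 huv with h0 | h1
  · rw [if_pos (by rw [Nat.odd_iff]; omega), Finset.mul_sum, add_comm]
    have huv' : u = v := hc.dist_eq_zero_iff.1 h0
    subst huv'
    refine Nat.add_le_add (Finset.sum_le_sum fun i hi => ?_) ?_
    · rw [Finset.mem_range] at hi
      rw [add_comm i 1]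
      refine le_trans (Nat.mul_le_mul_right _ ?_)
        (card_level_mul_pow_le hc huv hδ 1 i (by omega))
      refine (hδ u).trans ?_
      rw [ndeg, Set.ncard_eq_toFinset_card']
      refine Finset.card_le_card fun x hx => ?_
      rw [Set.mem_toFinset, mem_neighborSet] at hx
      simpa [edgeLevel] using hx
    · rw [Nat.one_le_iff_ne_zero, ← Nat.pos_iff_ne_zero, Finset.card_pos]
      exact ⟨u, by simp [edgeLevel]⟩
  · have hne : u ≠ v := (dist_eq_one_iff_adj.1 h1).ne
    have hzero : 2 ≤ (Finset.univ.filter fun w => edgeLevel G u v w = 0).card := by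
      rw [← Finset.card_pair hne]
      refine Finset.card_le_card fun x hx => ?_
      simp only [Finset.mem_insert, Finset.mem_singleton] at hx
      simpa using (edgeLevel_eq_zero_iff hc).2 hx
    rw [if_neg (by rw [Nat.odd_iff]; omega), add_comm, ← Finset.Ico_add_one_right_eq_Icc,
      Finset.sum_Ico_eq_sum_range, Nat.add_sub_cancel]
    refine Nat.add_le_add (Finset.sum_le_sum fun i hi => ?_) hzero
    rw [Finset.mem_range] at hi
    have := card_level_mul_pow_le hc huv hδ 0 (1 + i) (by omega)
    rw [zero_add, add_comm 1 i] at this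
    rw [add_comm 1 i]
    exact (Nat.mul_le_mul_right _ hzero).trans this

end Level

section Arc

variable {q : ℕ}

lemma exists_int_of_cycleDist_le [NeZero q] {i j : ZMod q} {m : ℕ} (h : cycleDist i j ≤ m) :
    ∃ z : ℤ, -(m : ℤ) ≤ z ∧ z ≤ m ∧ i = j + z := by
  rcases min_le_iff.1 h with h | h
  · exact ⟨(i - j).val, by omega, by omega, by simp⟩
  · exact ⟨-(j - i).val, by omega, by omega, by simp⟩

lemma cycleDist_add_natCast_le (i : ZMod q) (m : ℕ) : cycleDist i (i + m) ≤ m := by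
  refine (min_le_right _ _).trans ?_
  rw [add_sub_cancel_left, ZMod.val_natCast]
  exact Nat.mod_le _ _

lemma cycleDist_comm (i j : ZMod q) : cycleDist i j = cycleDist j i := min_comm _ _

lemma cycleDist_add_natCast_of_le_one (hq : 1 < q) (i : ZMod q) {c : ℕ} (hc : c ≤ 1) :
    cycleDist i (i + c) = c := by
  have : NeZero q := ⟨by omega⟩
  have : Fact (1 < q) := ⟨hq⟩
  refine le_antisymm (cycleDist_add_natCast_le i c) ?_
  rcases Nat.le_one_iff_eq_zero_or_eq_one.1 hc with rfl | rfl
  · exact Nat.zero_le _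
  · simp [cycleDist, Nat.one_le_iff_ne_zero]

lemma eq_of_intCast_eq {x y : ℤ} (h : (x : ZMod q) = y) (h1 : x - y < q) (h2 : y - x < q) :
    x = y := by
  rw [ZMod.intCast_eq_intCast_iff, Int.modEq_iff_dvd] at h
  have := Int.eq_zero_of_abs_lt_dvd h (by rw [abs_lt]; omega)
  omega

/-- A set of indices with pairwise cyclic distance at most `2k` lies in an arc of `2k + 1` indices;
if it, together with its translate by `-c`, has the largest possible size, then it contains both
ends of that arc. -/
lemma card_arc_le {k c : ℕ} (hq : 6 * k < q) (S : ZMod q → Prop)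
    (hS : ∀ i j, S i → S j → cycleDist i j ≤ 2 * k) (T : Finset (ZMod q))
    (hT : ∀ i, i ∈ T ↔ S i ∨ S (i + c)) :
    T.card ≤ 2 * k + 1 + c ∧
      (T.card = 2 * k + 1 + c → ∃ i : ZMod q, S (i - k) ∧ S (i + k)) := by
  classical
  have : NeZero q := ⟨by omega⟩
  by_cases hne : ∃ a, S a
  swap
  · have : T = ∅ := by
      ext i
      simp only [hT, Finset.notMem_empty, iff_false]
      exact fun h => hne (h.elim (fun h => ⟨_, h⟩) fun h => ⟨_, h⟩)
    rw [this, Finset.card_empty]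
    exact ⟨Nat.zero_le _, fun h => by omega⟩
  obtain ⟨a, ha⟩ := hne
  set Z : Finset ℤ := (Finset.Icc (-(2 * k : ℤ)) (2 * k)).filter fun z => S (a + z) with hZ
  have hZmem : ∀ i, S i → ∃ z ∈ Z, i = a + z := by
    intro i hi
    obtain ⟨z, h1, h2, rfl⟩ := exists_int_of_cycleDist_le (hS i a hi ha)
    refine ⟨z, ?_, rfl⟩
    rw [hZ, Finset.mem_filter, Finset.mem_Icc]
    push_cast at h1 h2
    exact ⟨⟨h1, h2⟩, hi⟩
  have hZne : Z.Nonempty := by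
    obtain ⟨z, hz, -⟩ := hZmem a ha
    exact ⟨z, hz⟩
  have hmin := Z.min'_mem hZne
  have hmax := Z.max'_mem hZne
  set m := Z.min' hZne
  set M := Z.max' hZne
  have hle : ∀ z ∈ Z, m ≤ z ∧ z ≤ M := fun z hz => ⟨Z.min'_le z hz, Z.le_max' z hz⟩
  rw [hZ, Finset.mem_filter, Finset.mem_Icc] at hmin hmax
  have hdiff : M - m ≤ 2 * k := by
    obtain ⟨z, h1, h2, h3⟩ := exists_int_of_cycleDist_le (hS _ _ hmax.2 hmin.2)
    have h4 : ((M : ℤ) : ZMod q) = ((m + z : ℤ) : ZMod q) := by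
      push_cast
      rw [add_assoc] at h3
      exact add_left_cancel h3
    have := eq_of_intCast_eq h4 (by omega) (by omega)
    omega
  have hsub : T ⊆ (Finset.Icc (m - c) M).image fun z : ℤ => a + (z : ZMod q) := by
    intro i hi
    rw [Finset.mem_image]
    rcases (hT i).1 hi with h | h
    · obtain ⟨z, hz, rfl⟩ := hZmem _ h
      have := hle z hz
      exact ⟨z, by rw [Finset.mem_Icc]; omega, rfl⟩
    · obtain ⟨z, hz, h⟩ := hZmem _ h
      have := hle z hz
      refine ⟨z - c, by rw [Finset.mem_Icc]; omega, ?_⟩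
      rw [eq_sub_of_add_eq h]
      push_cast
      ring
  have hcard := (Finset.card_le_card hsub).trans Finset.card_image_le
  rw [Int.card_Icc] at hcard
  refine ⟨by omega, fun hTc => ⟨a + m + k, ?_, ?_⟩⟩
  · rw [add_sub_cancel_right]
    exact hmin.2
  · have hM : M = m + k + k := by omega
    have := hmax.2
    rw [hM] at this
    push_cast at this
    rwa [← add_assoc, ← add_assoc] at this

/-- An index set with pairwise cyclic distance at most `2k` contains both ends of at most one arc
of `2k + 1` indices. -/
lemma arc_center_unique {k : ℕ} (hq : 6 * k < q) {S : ZMod q → Prop}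
    (hS : ∀ i j, S i → S j → cycleDist i j ≤ 2 * k) {i j : ZMod q}
    (hi : S (i - k) ∧ S (i + k)) (hj : S (j - k) ∧ S (j + k)) : i = j := by
  have : NeZero q := ⟨by omega⟩
  obtain ⟨x, hx1, hx2, hx⟩ := exists_int_of_cycleDist_le (hS _ _ hi.1 hj.1)
  obtain ⟨y, hy1, hy2, hy⟩ := exists_int_of_cycleDist_le (hS _ _ hi.2 hj.1)
  obtain ⟨z, hz1, hz2, hz⟩ := exists_int_of_cycleDist_le (hS _ _ hi.1 hj.2)
  have hxy : ((y : ℤ) : ZMod q) = ((x + 2 * k : ℤ) : ZMod q) := by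
    push_cast
    linear_combination hx - hy
  have hxz : ((z : ℤ) : ZMod q) = ((x - 2 * k : ℤ) : ZMod q) := by
    push_cast
    linear_combination hx - hz
  have h1 := eq_of_intCast_eq hxy (by omega) (by omega)
  have h2 := eq_of_intCast_eq hxz (by omega) (by omega)
  have h0 : x = 0 := by omega
  rw [h0, Int.cast_zero, add_zero] at hx
  exact sub_left_injective hx

end Arc

/-- Lemma 5.3: the sets `L i` partition the vertex set, and `u i ∈ L i`. -/
theorem stmt_8 {V : Type*} (G : SimpleGraph V) (δ g q k : ℕ)
    (hG : IsEquatorial G δ g q) (hk : k = (g + 1) / 2 - 1)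
    (f : ZMod q → V) (hf : IsIsoCycle G q f) :
    (∀ v : V, ∃! i : ZMod q, v ∈ Lpart G k f i) ∧
    (∀ i : ZMod q, f i ∈ Lpart G k f i) := by
  obtain ⟨hfin, hc, hgirth, hδ, -, hq, hcard⟩ := hG
  rw [← hk] at hq
  have hdist := hf.2
  have : NeZero q := ⟨by omega⟩
  refine ⟨fun v => ?_, fun i => ⟨?_, ?_⟩⟩
  · classical
    have : Fintype V := Fintype.ofFinite V
    have hg0 : g ≠ 0 := by
      rintro rfl
      simp only [zero_mul, mooreBound] at hcard
      simp at hcard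
      omega
    obtain ⟨c, hc1, hgc⟩ : ∃ c, c ≤ 1 ∧ g = 2 * k + 1 + c := ⟨g - (2 * k + 1), by omega, by omega⟩
    have hstep : ∀ i : ZMod q, G.dist (f i) (f (i + c)) = c := fun i => by
      rw [hdist, cycleDist_add_natCast_of_le_one (by omega) i hc1]
    have hS : ∀ w i j, G.dist (f i) w ≤ k → G.dist (f j) w ≤ k → cycleDist i j ≤ 2 * k := by
      intro w i j hi hj
      have htri := hc.dist_triangle (u := f i) (v := w) (w := f j)
      rw [hdist, G.dist_comm (u := w)] at htri
      omega
    let r : ZMod q → V → Prop := fun i w => edgeLevel G (f i) (f (i + c)) w ≤ k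
    have hT : ∀ w i, i ∈ Finset.univ.bipartiteBelow r w ↔
        G.dist (f i) w ≤ k ∨ G.dist (f (i + c)) w ≤ k := fun w i => by
      simp [r, Finset.mem_bipartiteBelow, edgeLevel]
    have harc := fun w => card_arc_le (c := c) (by omega) _ (hS w) _ (hT w)
    have hupper : ∀ w ∈ (Finset.univ : Finset V), (Finset.univ.bipartiteBelow r w).card ≤ g :=
      fun w _ => (harc w).1.trans_eq hgc.symm
    have hlower : ∀ i ∈ (Finset.univ : Finset (ZMod q)),
        mooreBound δ g ≤ (Finset.univ.bipartiteAbove r i).card := fun i _ =>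
      mooreBound_le_card_level_le hc hgirth hδ.1 ((hstep i).trans_le hc1) (by rw [hstep]; exact hgc)
    have hsum : ∑ w : V, (Finset.univ.bipartiteBelow r w).card = ∑ _w : V, g := by
      refine le_antisymm (Finset.sum_le_sum hupper) ?_
      rw [← Finset.sum_card_bipartiteAbove_eq_sum_card_bipartiteBelow]
      refine le_trans (le_of_eq ?_) (Finset.sum_le_sum hlower)
      rw [Finset.sum_const, Finset.sum_const, Finset.card_univ, Finset.card_univ, ZMod.card,
        smul_eq_mul, smul_eq_mul, ← Nat.card_eq_fintype_card, mul_comm, hcard]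
    have hv := (Finset.sum_eq_sum_iff_of_le hupper).1 hsum v (Finset.mem_univ v)
    obtain ⟨i, hi⟩ := (harc v).2 (hv.trans hgc)
    exact ⟨i, hi, fun j hj => arc_center_unique (by omega) (hS v) hj hi⟩
  · have h := cycleDist_add_natCast_le (i - (k : ZMod q)) k
    rw [sub_add_cancel, ← hdist] at h
    exact h
  · have h := cycleDist_add_natCast_le i k
    rw [cycleDist_comm, ← hdist] at h
    exact h
end

section
/- Let C = u_0, …, u_{q−1} be an isometric cycle of maximum length q in an equatorial graph of girth g with k = ⌈g/2⌉ − 1, let e_i = u_i u_{i+1}, and let L_i be the parts of the partition induced by C (subscripts mod q). If g is odd, then D_k(u_i) = L_{i−k} ∪ L_{i−k+1} ∪ ⋯ ∪ L_{i+k} for every i ∈ [0, q−1]. If g is even, then D_k(e_i) = L_{i−k} ∪ L_{i−k+1} ∪ ⋯ ∪ L_{i+k+1} for every i ∈ [0, q−1]. -/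
open SimpleGraph

open Finset

namespace EquatorialGraph

section Girth

variable {V : Type*} {G : SimpleGraph V}

/-- Two paths with the same ends and total length below the girth coincide. -/
lemma path_unique_of_length_add_lt_girth {u v : V} {p p' : G.Walk u v} (hp : p.IsPath)
    (hp' : p'.IsPath) (h : p.length + p'.length < G.girth) : p = p' := by
  classical
  let H : SimpleGraph V := fromEdgeSet {e | e ∈ p.edges ∨ e ∈ p'.edges}
  have mem_H : ∀ e ∈ G.edgeSet, (e ∈ p.edges ∨ e ∈ p'.edges) → e ∈ H.edgeSet := by
    intro e he hm
    rw [edgeSet_fromEdgeSet]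
    exact ⟨hm, G.not_isDiag_of_mem_edgeSet he⟩
  have hHG : H ≤ G := by
    intro a b hab
    rw [fromEdgeSet_adj] at hab
    rcases hab.1 with h1 | h1
    · exact p.adj_of_mem_edges h1
    · exact p'.adj_of_mem_edges h1
  have hpH : ∀ e ∈ p.edges, e ∈ H.edgeSet := fun e he =>
    mem_H e (p.edges_subset_edgeSet he) (Or.inl he)
  have hpH' : ∀ e ∈ p'.edges, e ∈ H.edgeSet := fun e he =>
    mem_H e (p'.edges_subset_edgeSet he) (Or.inr he)
  have hac : H.IsAcyclic := by
    intro a c hc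
    have hc' := hc.mapLe hHG
    have hle : G.girth ≤ c.length := by
      simpa using hc'.girth_le_length
    have hsub : c.edges ⊆ p.edges ++ p'.edges := by
      intro e he
      have := c.edges_subset_edgeSet he
      rw [edgeSet_fromEdgeSet] at this
      exact List.mem_append.2 this.1
    have := (hc.edges_nodup.subperm hsub).length_le
    simp at this
    omega
  have heq := congrArg Subtype.val
    ((hac.subsingleton_path u v).elim ⟨p.transfer H hpH, hp.transfer hpH⟩ ⟨p'.transfer H hpH', hp'.transfer hpH'⟩)
  apply Walk.ext_support
  simpa using congrArg Walk.support heq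

/-- A shortest walk to `a` extends to a path to a neighbour `x` which is at least as far. -/
lemma exists_isPath_penultimate (hG : G.Connected) {v a x : V} (h : G.Adj a x)
    (hd : G.dist v a ≤ G.dist v x) :
    ∃ p : G.Walk v x, p.IsPath ∧ p.length = G.dist v a + 1 ∧ p.penultimate = a := by
  classical
  obtain ⟨p, hp, hl⟩ := hG.exists_path_of_dist v a
  refine ⟨p.concat h, hp.concat ?_ h, by simp [hl], by simp⟩
  intro hx
  have h1 := dist_le (p.takeUntil x hx)
  have h2 := Walk.length_takeUntil_lt_length hx h.ne'
  omega

lemma neighbor_unique_of_dist_le (hG : G.Connected) {v a b x : V} (ha : G.Adj a x)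
    (hb : G.Adj b x) (hda : G.dist v a ≤ G.dist v x) (hdb : G.dist v b ≤ G.dist v x)
    (h : G.dist v a + G.dist v b + 2 < G.girth) : a = b := by
  obtain ⟨p, hp, hl, rfl⟩ := exists_isPath_penultimate hG ha hda
  obtain ⟨p', hp', hl', rfl⟩ := exists_isPath_penultimate hG hb hdb
  rw [path_unique_of_length_add_lt_girth hp hp' (by omega)]

lemma dist_le_succ_of_adj (hG : G.Connected) {v x y : V} (h : G.Adj x y) :
    G.dist v y ≤ G.dist v x + 1 := by
  have := hG.dist_triangle (u := v) (v := x) (w := y)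
  rwa [dist_eq_one_iff_adj.2 h] at this

/-- All neighbours of `x` except one are farther away from `v` than `x`. -/
lemma exists_forall_neighbor_dist_eq (hG : G.Connected) {v x : V} (hx : G.dist v x ≠ 0)
    (h : 2 * G.dist v x + 1 < G.girth) :
    ∃ p, ∀ y, G.Adj x y → y ≠ p → G.dist v y = G.dist v x + 1 := by
  obtain ⟨w, hw⟩ := hG.exists_walk_length_eq_dist v x
  have hnil : ¬ w.Nil := by
    intro hn
    exact hx (hw ▸ Walk.length_eq_zero_iff.2 hn)
  have hadj := w.adj_penultimate hnil
  have h1 := dist_le w.dropLast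
  have h2 : w.dropLast.length = w.length - 1 := by simp
  refine ⟨w.penultimate, fun y hy hne => ?_⟩
  by_contra hcon
  have h3 := dist_le_succ_of_adj hG (v := v) hy
  exact hne (neighbor_unique_of_dist_le hG (v := v) hy.symm hadj (by omega) (by omega) (by omega))

end Girth

section Moore

variable {V : Type*} [Fintype V] {G : SimpleGraph V}

open Classical in
lemma ndeg_eq_card_filter (x : V) : ndeg G x = #{y | G.Adj x y} := by
  rw [ndeg, ← Set.ncard_coe_finset]
  congr 1
  ext y
  simp

lemma mul_card_le_card_of_unique_parent {δ : ℕ} (hδ : ∀ x, δ ≤ ndeg G x) (A B : Finset V)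
    (hAB : ∀ x ∈ A, ∃ p, ∀ y, G.Adj x y → y ≠ p → y ∈ B)
    (hBA : ∀ y ∈ B, ∀ a ∈ A, ∀ b ∈ A, G.Adj a y → G.Adj b y → a = b) :
    (δ - 1) * #A ≤ #B := by
  classical
  have := card_mul_le_card_mul G.Adj (s := A) (t := B) (m := δ - 1) (n := 1) ?_ ?_
  · linarith
  · intro x hx
    obtain ⟨p, hp⟩ := hAB x hx
    have hsub : ({y | G.Adj x y} : Finset V).erase p ⊆ B.bipartiteAbove G.Adj x := by
      intro y hy
      simp only [mem_erase, mem_filter, mem_univ, true_and] at hy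
      simp only [mem_bipartiteAbove]
      exact ⟨hp y hy.2 hy.1, hy.2⟩
    have h1 := card_le_card hsub
    have h2 := pred_card_le_card_erase (s := ({y | G.Adj x y} : Finset V)) (a := p)
    have h3 := hδ x
    rw [ndeg_eq_card_filter] at h3
    omega
  · intro y hy
    rw [card_le_one]
    intro a ha b hb
    simp only [mem_bipartiteBelow] at ha hb
    exact hBA y hy a ha.1 b hb.1 ha.2 hb.2

open Classical in
lemma moore_sphere_bound (hG : G.Connected) {δ : ℕ} (hδ : ∀ x, δ ≤ ndeg G x) (u : V) (i : ℕ)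
    (hi : 2 * (i + 1) < G.girth) : δ * (δ - 1) ^ i ≤ #{x | G.dist u x = i + 1} := by
  induction i with
  | zero =>
    have h := hδ u
    rw [ndeg_eq_card_filter] at h
    simpa [dist_eq_one_iff_adj] using h
  | succ i ih =>
    have h := mul_card_le_card_of_unique_parent hδ {x | G.dist u x = i + 1}
      {x | G.dist u x = i + 1 + 1} ?_ ?_
    · calc δ * (δ - 1) ^ (i + 1) = (δ - 1) * (δ * (δ - 1) ^ i) := by ring
        _ ≤ _ := Nat.mul_le_mul_left _ (ih (by omega))
        _ ≤ _ := h
    · intro x hx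
      simp only [mem_filter, mem_univ, true_and] at hx ⊢
      simpa only [hx] using
        exists_forall_neighbor_dist_eq hG (v := u) (x := x) (by omega) (by omega)
    · intro y hy a ha b hb hay hby
      simp only [mem_filter, mem_univ, true_and] at hy ha hb
      exact neighbor_unique_of_dist_le hG hay hby (by omega) (by omega) (v := u) (by omega)

lemma moore_disk_bound (hG : G.Connected) {δ k : ℕ} (hδ : ∀ x, δ ≤ ndeg G x) (u : V)
    (hk : 2 * k < G.girth) : 1 + δ * ∑ i ∈ range k, (δ - 1) ^ i ≤ (disk G k u).ncard := by
  classical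
  have hD : disk G k u = ({x | G.dist u x ≤ k} : Finset V) := by
    ext x
    simp [disk]
  rw [hD, Set.ncard_coe_finset, card_eq_sum_card_fiberwise (f := G.dist u) (t := range (k + 1))
    (by intro x hx; simp at hx ⊢; omega), sum_range_succ', add_comm, mul_sum]
  refine add_le_add (sum_le_sum fun i hi => ?_) (card_pos.2 ⟨u, by simp⟩)
  rw [mem_range] at hi
  refine (moore_sphere_bound hG hδ u i (by omega)).trans (card_le_card fun x hx => ?_)
  simp only [mem_filter, mem_univ, true_and] at hx ⊢
  omega

open Classical in
lemma moore_edge_sphere_bound (hG : G.Connected) {δ : ℕ} (hδ : ∀ x, δ ≤ ndeg G x) {u v : V}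
    (huv : G.Adj u v) (i : ℕ) (hi : 2 * i + 1 < G.girth) :
    (δ - 1) ^ i ≤ #{x | G.dist u x = i ∧ G.dist v x = i + 1} := by
  induction i with
  | zero =>
    rw [pow_zero, Nat.one_le_iff_ne_zero, ← Nat.pos_iff_ne_zero, card_pos]
    exact ⟨u, by simp [dist_eq_one_iff_adj, huv.symm]⟩
  | succ i ih =>
    have h := mul_card_le_card_of_unique_parent hδ {x | G.dist u x = i ∧ G.dist v x = i + 1}
      {x | G.dist u x = i + 1 ∧ G.dist v x = i + 1 + 1} ?_ ?_
    · calc (δ - 1) ^ (i + 1) = (δ - 1) * (δ - 1) ^ i := by ring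
        _ ≤ _ := Nat.mul_le_mul_left _ (ih (by omega))
        _ ≤ _ := h
    · intro x hx
      simp only [mem_filter, mem_univ, true_and] at hx ⊢
      obtain ⟨p, hp⟩ :=
        exists_forall_neighbor_dist_eq hG (v := v) (x := x) (by omega) (by omega)
      refine ⟨p, fun y hy hne => ?_⟩
      have h1 := hp y hy hne
      have h2 := dist_le_succ_of_adj hG (v := u) hy
      have h3 := dist_le_succ_of_adj hG (v := y) huv
      rw [dist_comm, dist_comm (u := y) (v := u)] at h3
      omega
    · intro y hy a ha b hb hay hby
      simp only [mem_filter, mem_univ, true_and] at hy ha hb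
      exact neighbor_unique_of_dist_le hG hay hby (by omega) (by omega) (v := u) (by omega)

open Classical in
lemma moore_half_edisk_bound (hG : G.Connected) {δ k : ℕ} (hδ : ∀ x, δ ≤ ndeg G x) {u v : V}
    (huv : G.Adj u v) (hk : 2 * k + 1 < G.girth) :
    ∑ i ∈ range (k + 1), (δ - 1) ^ i ≤ #{x | G.dist u x ≤ k ∧ G.dist v x = G.dist u x + 1} := by
  rw [card_eq_sum_card_fiberwise (f := G.dist u) (t := range (k + 1))
    (by intro x hx; simp at hx ⊢; omega)]
  refine sum_le_sum fun i hi => ?_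
  rw [mem_range] at hi
  refine (moore_edge_sphere_bound hG hδ huv i (by omega)).trans (card_le_card fun x hx => ?_)
  simp only [mem_filter, mem_univ, true_and] at hx ⊢
  omega

lemma moore_edisk_bound (hG : G.Connected) {δ k : ℕ} (hδ : ∀ x, δ ≤ ndeg G x) {u v : V}
    (huv : G.Adj u v) (hk : 2 * k + 1 < G.girth) :
    2 + ∑ i ∈ Icc 1 k, 2 * (δ - 1) ^ i ≤ (edisk G k u v).ncard := by
  classical
  have hsum : 2 + ∑ i ∈ Icc 1 k, 2 * (δ - 1) ^ i = 2 * ∑ i ∈ range (k + 1), (δ - 1) ^ i := by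
    rw [range_eq_Ico, sum_eq_sum_Ico_succ_bot (by omega), mul_add, mul_sum]
    rfl
  have h1 := moore_half_edisk_bound hG hδ huv hk
  have h2 := moore_half_edisk_bound hG hδ huv.symm hk
  have hdisj : Disjoint ({x | G.dist u x ≤ k ∧ G.dist v x = G.dist u x + 1} : Finset V)
      ({x | G.dist v x ≤ k ∧ G.dist u x = G.dist v x + 1} : Finset V) := by
    rw [Finset.disjoint_left]
    intro x hx hx'
    simp only [mem_filter, mem_univ, true_and] at hx hx'
    omega
  have h3 := card_union_of_disjoint hdisj
  rw [← Set.ncard_coe_finset] at h3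
  have h4 := Set.ncard_le_ncard (t := edisk G k u v) (s := ((({x | G.dist u x ≤ k ∧
    G.dist v x = G.dist u x + 1} : Finset V) ∪ ({x | G.dist v x ≤ k ∧
    G.dist u x = G.dist v x + 1} : Finset V) : Finset V) : Set V)) (by
      intro x hx
      simp only [coe_union, coe_filter, mem_univ, true_and, Set.mem_union, Set.mem_ofPred_eq] at hx
      exact hx.imp (fun h => h.1) (fun h => h.1)) (Set.toFinite _)
  omega

end Moore

section Counting

/-- In a family of sets of size at least `M` covering each point at most `g` times, attaining the
double-counting bound forces every point to be covered exactly `g` times. -/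
lemma card_cover_eq_of_tight {ι V : Type*} [Fintype ι] [Fintype V] (E : ι → Set V) {g M : ℕ}
    (hM : ∀ i, M ≤ (E i).ncard) (hg : ∀ v, {i | v ∈ E i}.ncard ≤ g)
    (h : g * Fintype.card V = Fintype.card ι * M) (v : V) : {i | v ∈ E i}.ncard = g := by
  classical
  have hE : ∀ i, (E i).ncard = #((univ : Finset V).bipartiteAbove (fun i v => v ∈ E i) i) := by
    intro i
    rw [← Set.ncard_coe_finset]
    congr 1
    ext
    simp
  have hI : ∀ v, {i | v ∈ E i}.ncard =
      #((univ : Finset ι).bipartiteBelow (fun i v => v ∈ E i) v) := by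
    intro v
    rw [← Set.ncard_coe_finset]
    congr 1
    ext
    simp
  have hsum : ∑ v, {i | v ∈ E i}.ncard = ∑ _v : V, g := by
    refine le_antisymm (sum_le_sum fun v _ => hg v) ?_
    calc ∑ _v : V, g = ∑ _i : ι, M := by simp; linarith
      _ ≤ ∑ i, (E i).ncard := sum_le_sum fun i _ => hM i
      _ = ∑ v, {i | v ∈ E i}.ncard := by
        simp only [hE, hI]
        exact sum_card_bipartiteAbove_eq_sum_card_bipartiteBelow _
  exact (sum_eq_sum_iff_of_le fun v _ => hg v).1 hsum v (mem_univ v)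

end Counting

section Arc

variable {q : ℕ}

/-- The arc of `l` consecutive indices starting at `a`. -/
def arc (a : ZMod q) (l : ℕ) : Finset (ZMod q) := (range l).image fun m : ℕ => a + (m : ZMod q)

lemma mem_arc {a x : ZMod q} {l : ℕ} : x ∈ arc a l ↔ ∃ m < l, x = a + (m : ZMod q) := by
  simp [arc, eq_comm]

lemma card_arc_le (a : ZMod q) (l : ℕ) : #(arc a l) ≤ l := by
  simpa [arc] using card_image_le (s := range l) (f := fun m : ℕ => a + (m : ZMod q))

lemma natCast_inj_of_lt {a b : ℕ} (ha : a < q) (hb : b < q) (h : (a : ZMod q) = b) : a = b := by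
  rw [ZMod.natCast_eq_natCast_iff'] at h
  rwa [Nat.mod_eq_of_lt ha, Nat.mod_eq_of_lt hb] at h

lemma cycleDist_add_natCast {a : ZMod q} {m : ℕ} (hm : m < q) :
    cycleDist (a + (m : ZMod q)) a = min m (q - m) := by
  have : NeZero q := ⟨by omega⟩
  rw [cycleDist, add_sub_cancel_left, sub_add_cancel_left, ZMod.neg_val, ZMod.val_natCast_of_lt hm]
  split_ifs with h
  · have : m = 0 := natCast_inj_of_lt hm (by omega) (by simpa using h)
    omega
  · rfl

lemma exists_natCast_of_cycleDist_le [NeZero q] {a b : ZMod q} {n : ℕ} (h : cycleDist a b ≤ n) :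
    ∃ t ≤ 2 * n, a = b - n + (t : ZMod q) := by
  rcases min_le_iff.1 h with h | h
  · refine ⟨n + (a - b).val, by omega, ?_⟩
    rw [Nat.cast_add, ZMod.natCast_zmod_val]
    ring
  · refine ⟨n - (b - a).val, by omega, ?_⟩
    rw [Nat.cast_sub h, ZMod.natCast_zmod_val]
    ring

/-- A set of indices of small diameter on a long cycle lies on a short arc. -/
lemma exists_subset_arc {n : ℕ} (hq : 3 * n < q) (S : Set (ZMod q))
    (hS : ∀ a ∈ S, ∀ b ∈ S, cycleDist a b ≤ n) : ∃ a : ZMod q, S ⊆ (arc a (n + 1) : Set (ZMod q)) := by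
  classical
  have : NeZero q := ⟨by omega⟩
  rcases S.eq_empty_or_nonempty with rfl | ⟨s, hs⟩
  · exact ⟨0, by simp⟩
  have hex : ∃ t : ℕ, s - n + (t : ZMod q) ∈ S := ⟨n, by simpa using hs⟩
  refine ⟨s - n + (Nat.find hex : ℕ), fun x hx => ?_⟩
  obtain ⟨t, ht, rfl⟩ := exists_natCast_of_cycleDist_le (hS x hx s hs)
  have hmin := Nat.find_min' hex hx
  have hd := hS _ hx _ (Nat.find_spec hex)
  rw [show s - n + (t : ZMod q) = s - n + (Nat.find hex : ℕ) + (t - Nat.find hex : ℕ) by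
    rw [Nat.cast_sub hmin]; ring, cycleDist_add_natCast (by omega)] at hd
  rw [mem_coe, mem_arc]
  refine ⟨t - Nat.find hex, by omega, ?_⟩
  rw [Nat.cast_sub hmin]
  ring

lemma sub_one_notMem_arc {a : ZMod q} {l : ℕ} (hl : l < q) : a - 1 ∉ arc a l := by
  intro h
  obtain ⟨m, hm, h⟩ := mem_arc.1 h
  have h' : ((m + 1 : ℕ) : ZMod q) = (0 : ℕ) := by
    push_cast
    linear_combination -h
  have := natCast_inj_of_lt (by omega) (by omega) h'
  omega

lemma add_natCast_notMem_arc {a : ZMod q} {l : ℕ} (hl : l < q) : a + (l : ZMod q) ∉ arc a l := by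
  intro h
  obtain ⟨m, hm, h⟩ := mem_arc.1 h
  have := natCast_inj_of_lt (by omega) hl (add_left_cancel h).symm
  omega

lemma eq_of_mem_arc_of_add_mem_arc {a b : ZMod q} {n : ℕ} (hq : 2 * n < q)
    (h : b ∈ arc a (n + 1)) (h' : b + (n : ZMod q) ∈ arc a (n + 1)) : b = a := by
  obtain ⟨m, hm, rfl⟩ := mem_arc.1 h
  obtain ⟨m', hm', h'⟩ := mem_arc.1 h'
  have h2 : ((m + n : ℕ) : ZMod q) = (m' : ℕ) := by
    push_cast
    linear_combination h'
  have := natCast_inj_of_lt (by omega) (by omega) h2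
  obtain rfl : m = 0 := by omega
  simp

lemma mem_arc_sub_comm {a b : ZMod q} {l n : ℕ} (hl : l = n + 1) :
    a ∈ arc b l ↔ b ∈ arc (a - (n : ZMod q)) l := by
  subst hl
  simp only [mem_arc]
  constructor
  · rintro ⟨m, hm, rfl⟩
    refine ⟨n - m, by omega, ?_⟩
    rw [Nat.cast_sub (by omega)]
    ring
  · rintro ⟨m, hm, rfl⟩
    refine ⟨n - m, by omega, ?_⟩
    rw [Nat.cast_sub (by omega)]
    ring

end Arc

section Partition

variable {V : Type*} {G : SimpleGraph V} {q k : ℕ} {f : ZMod q → V}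

lemma exists_disk_indices_subset_arc (hG : G.Connected) (hf : IsIsoCycle G q f)
    (hq : 6 * k < q) (v : V) : ∃ a : ZMod q, {i | v ∈ disk G k (f i)} ⊆ (arc a (2 * k + 1) : Set (ZMod q)) := by
  refine exists_subset_arc (by omega) _ fun a ha b hb => ?_
  have h1 : G.dist (f a) v ≤ k := ha
  have h2 : G.dist (f b) v ≤ k := hb
  have h3 := hG.dist_triangle (u := f a) (v := v) (w := f b)
  rw [hf.2, dist_comm (u := v)] at h3
  omega

lemma adj_succ (hf : IsIsoCycle G q f) (i : ZMod q) : G.Adj (f i) (f (i + 1)) := by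
  have hq := hf.1
  have h := cycleDist_add_natCast (a := i) (m := 1) (q := q) (by omega)
  rw [Nat.cast_one, ← hf.2] at h
  rw [← dist_eq_one_iff_adj, dist_comm, h]
  omega

/-- If the disks containing `v` are centred on a short arc with both ends attained, that arc
determines the part of `v`. -/
lemma mem_Lpart_iff {v : V} {a : ZMod q} (hq : 4 * k < q)
    (hS : {i | v ∈ disk G k (f i)} ⊆ (arc a (2 * k + 1) : Set (ZMod q))) (h0 : v ∈ disk G k (f a))
    (h1 : v ∈ disk G k (f (a + (2 * k : ℕ)))) (j : ZMod q) :
    v ∈ Lpart G k f j ↔ j = a + k := by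
  constructor
  · rintro ⟨hl, hr⟩
    have := eq_of_mem_arc_of_add_mem_arc (n := 2 * k) (b := j - (k : ZMod q)) (by omega) (hS hl) (by
      have := hS hr
      rwa [show j - (k : ZMod q) + (2 * k : ℕ) = j + k by push_cast; ring])
    rw [← this]
    ring
  · rintro rfl
    refine ⟨by simpa using h0, ?_⟩
    rwa [show a + (k : ZMod q) + k = a + (2 * k : ℕ) by push_cast; ring]

lemma mem_biUnion_Lpart_iff {v : V} {a : ZMod q} (hL : ∀ j, v ∈ Lpart G k f j ↔ j = a + k)
    (i : ZMod q) (l : ℕ) :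
    v ∈ (⋃ m ∈ range l, Lpart G k f (i - (k : ZMod q) + (m : ZMod q))) ↔
      a + k ∈ arc (i - (k : ZMod q)) l := by
  simp only [Set.mem_iUnion, hL, mem_range, exists_prop, mem_arc, eq_comm]

lemma eq_coe_of_subset_of_ncard {S : Set (ZMod q)} {a : ZMod q} {l : ℕ} (h : S ⊆ (arc a l : Set (ZMod q)))
    (hc : S.ncard = l) : S = (arc a l : Set (ZMod q)) := by
  refine Set.eq_of_subset_of_ncard_le h ?_ (finite_toSet _)
  rw [Set.ncard_coe_finset, hc]
  exact card_arc_le a l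

lemma ncard_le_of_subset_arc {S : Set (ZMod q)} {a : ZMod q} {l : ℕ} (h : S ⊆ (arc a l : Set (ZMod q))) :
    S.ncard ≤ l := by
  refine (Set.ncard_le_ncard h (finite_toSet _)).trans ?_
  rw [Set.ncard_coe_finset]
  exact card_arc_le a l

lemma edisk_indices_subset_arc {v : V} {a : ZMod q}
    (h : {i | v ∈ disk G k (f i)} ⊆ (arc a (2 * k + 1) : Set (ZMod q))) :
    {i | v ∈ edisk G k (f i) (f (i + 1))} ⊆ (arc (a - 1) (2 * k + 2) : Set (ZMod q)) := by
  rintro i (hi | hi)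
  · obtain ⟨m, hm, rfl⟩ := mem_arc.1 (h hi)
    exact mem_arc.2 ⟨m + 1, by omega, by push_cast; ring⟩
  · obtain ⟨m, hm, h'⟩ := mem_arc.1 (h hi)
    exact mem_arc.2 ⟨m, by omega, by linear_combination h'⟩

end Partition

end EquatorialGraph

open EquatorialGraph in
/-- Lemma 5.4: each disk around a vertex/edge of the isometric `q`-cycle is the union of
`g` consecutive parts of the induced partition. -/
theorem stmt_9 {V : Type*} (G : SimpleGraph V) (δ g q k : ℕ)
    (hG : IsEquatorial G δ g q) (hk : k = (g + 1) / 2 - 1)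
    (f : ZMod q → V) (hf : IsIsoCycle G q f) :
    (Odd g → ∀ i : ZMod q, disk G k (f i) =
      ⋃ m ∈ Finset.range (2 * k + 1), Lpart G k f (i - (k : ZMod q) + (m : ZMod q))) ∧
    (Even g → ∀ i : ZMod q, edisk G k (f i) (f (i + 1)) =
      ⋃ m ∈ Finset.range (2 * k + 2), Lpart G k f (i - (k : ZMod q) + (m : ZMod q))) := by
  obtain ⟨hfin, hconn, hgirth, ⟨hδ, -⟩, -, hq, hcard⟩ := hG
  have := Fintype.ofFinite V
  have hq3 := hf.1
  have : NeZero q := ⟨by omega⟩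
  rw [← hk] at hq
  have hcard' : g * Fintype.card V = Fintype.card (ZMod q) * mooreBound δ g := by
    rw [ZMod.card, ← Nat.card_eq_fintype_card, hcard]
  constructor
  · rintro ⟨c, rfl⟩ i
    obtain rfl : k = c := by omega
    have hM : ∀ i, mooreBound δ (2 * k + 1) ≤ (disk G k (f i)).ncard := by
      intro i
      rw [mooreBound, if_pos ⟨k, rfl⟩, ← hk]
      exact moore_disk_bound hconn hδ (f i) (by omega)
    ext v
    obtain ⟨a, ha⟩ := exists_disk_indices_subset_arc hconn hf (k := k) (by omega) v
    have hI := eq_coe_of_subset_of_ncard ha (card_cover_eq_of_tight (fun i => disk G k (f i)) hM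
      (fun v => (exists_disk_indices_subset_arc hconn hf (by omega) v).elim
        fun _ h => ncard_le_of_subset_arc h) hcard' v)
    have hmem : ∀ i, v ∈ disk G k (f i) ↔ i ∈ arc a (2 * k + 1) := fun i =>
      Set.ext_iff.1 hI i
    rw [mem_biUnion_Lpart_iff (mem_Lpart_iff (by omega) ha
      ((hmem _).2 (mem_arc.2 ⟨0, by omega, by simp⟩))
      ((hmem _).2 (mem_arc.2 ⟨2 * k, by omega, rfl⟩))), hmem, mem_arc_sub_comm rfl]
    simp only [mem_arc]
    refine exists_congr fun m => and_congr_right fun _ => ?_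
    push_cast
    constructor <;> intro h <;> linear_combination h
  · rintro hg i
    have hpos : g ≠ 0 := by
      rintro rfl
      simp [mooreBound] at hcard
      omega
    obtain rfl : g = 2 * k + 2 := by
      obtain ⟨c, rfl⟩ := hg
      omega
    have hM : ∀ i, mooreBound δ (2 * k + 2) ≤ (edisk G k (f i) (f (i + 1))).ncard := by
      intro i
      rw [mooreBound, if_neg (Nat.not_odd_iff_even.2 hg), ← hk]
      exact moore_edisk_bound hconn hδ (adj_succ hf i) (by omega)
    ext v
    obtain ⟨a, ha⟩ := exists_disk_indices_subset_arc hconn hf (k := k) (by omega) v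
    have hI := eq_coe_of_subset_of_ncard (edisk_indices_subset_arc ha)
      (card_cover_eq_of_tight (fun i => edisk G k (f i) (f (i + 1))) hM
      (fun v => (exists_disk_indices_subset_arc hconn hf (by omega) v).elim
        fun _ h => ncard_le_of_subset_arc (edisk_indices_subset_arc h)) hcard' v)
    have hmem : ∀ i, v ∈ edisk G k (f i) (f (i + 1)) ↔ i ∈ arc (a - 1) (2 * k + 2) := fun i =>
      Set.ext_iff.1 hI i
    have h0 : v ∈ disk G k (f a) := by
      rcases (hmem (a - 1)).2 (mem_arc.2 ⟨0, by omega, by simp⟩) with h | h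
      · exact absurd (ha h) (sub_one_notMem_arc (by omega))
      · simpa using h
    have h1 : v ∈ disk G k (f (a + (2 * k : ℕ))) := by
      rcases (hmem (a + (2 * k : ℕ))).2
        (mem_arc.2 ⟨2 * k + 1, by omega, by push_cast; ring⟩) with h | h
      · exact h
      · refine absurd (ha h) ?_
        rw [show a + ((2 * k : ℕ) : ZMod q) + 1 = a + (2 * k + 1 : ℕ) by push_cast; ring]
        exact add_natCast_notMem_arc (by omega)
    rw [mem_biUnion_Lpart_iff (mem_Lpart_iff (by omega) ha h0 h1), hmem, mem_arc_sub_comm rfl]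
    simp only [mem_arc]
    refine exists_congr fun m => and_congr_right fun _ => ?_
    push_cast
    constructor <;> intro h <;> linear_combination h
end

section
/- Let G be an equatorial graph with equator q, let C be an isometric cycle of length q in G, and let {L_i : i ∈ [0, q−1]} be the partition of G induced by C. If a vertex of L_i is adjacent in G to a vertex of L_j, then |j − i| ≤ 1, where the difference is taken modulo q (i.e., j ∈ {i−1, i, i+1} mod q). -/
open SimpleGraph

/-- Indices at cyclic distance at most `r` differ by (the class of) an integer of absolute value
at most `r`. -/
lemma exists_int_abs_le_of_cycleDist_le {q : ℕ} [NeZero q] {a b : ZMod q} {r : ℕ}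
    (h : cycleDist a b ≤ r) : ∃ m : ℤ, |m| ≤ r ∧ a - b = (m : ZMod q) := by
  rcases min_le_iff.1 h with h | h
  · exact ⟨(a - b).val, by rw [Nat.abs_cast]; exact_mod_cast h, by simp⟩
  · exact ⟨-((b - a).val : ℤ), by rw [abs_neg, Nat.abs_cast]; exact_mod_cast h, by simp⟩

/-- Adjacent vertices in the disks of radius `k` around two vertices of an isometric cycle force
the indices of these two vertices to be at cyclic distance at most `2 * k + 1`. -/
lemma cycleDist_le_of_adj_disk {V : Type*} {G : SimpleGraph V} (hG : G.Connected) {q k : ℕ}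
    {f : ZMod q → V} (hf : IsIsoCycle G q f) {a b : ZMod q} {u v : V}
    (hu : u ∈ disk G k (f a)) (hv : v ∈ disk G k (f b)) (hadj : G.Adj u v) :
    cycleDist b a ≤ 2 * k + 1 := by
  have hu : G.dist (f a) u ≤ k := hu
  have hv : G.dist (f b) v ≤ k := hv
  have huv : G.dist v u = 1 := dist_eq_one_iff_adj.2 hadj.symm
  have h₁ : G.dist (f b) (f a) ≤ G.dist (f b) v + G.dist v (f a) := hG.dist_triangle
  have h₂ : G.dist v (f a) ≤ G.dist v u + G.dist u (f a) := hG.dist_triangle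
  rw [G.dist_comm (u := u)] at h₂
  rw [← hf.2]
  omega

/-- Lemma 5.5: a vertex of `L i` is adjacent to a vertex of `L j` only if
`|j - i| ≤ 1` (mod `q`). -/
theorem stmt_10 {V : Type*} (G : SimpleGraph V) (δ g q k : ℕ)
    (hG : IsEquatorial G δ g q) (hk : k = (g + 1) / 2 - 1)
    (f : ZMod q → V) (hf : IsIsoCycle G q f)
    (i j : ZMod q) (u v : V) (hu : u ∈ Lpart G k f i) (hv : v ∈ Lpart G k f j)
    (hadj : G.Adj u v) :
    j = i - 1 ∨ j = i ∨ j = i + 1 := by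
  obtain ⟨-, hconn, -, -, -, hq, -⟩ := hG
  rw [← hk] at hq
  have : NeZero q := ⟨by omega⟩
  obtain ⟨m, hm, em⟩ := exists_int_abs_le_of_cycleDist_le
    (cycleDist_le_of_adj_disk hconn hf hu.1 hv.1 hadj)
  obtain ⟨a, ha, ea⟩ := exists_int_abs_le_of_cycleDist_le
    (cycleDist_le_of_adj_disk hconn hf hu.1 hv.2 hadj)
  obtain ⟨b, hb, eb⟩ := exists_int_abs_le_of_cycleDist_le
    (cycleDist_le_of_adj_disk hconn hf hu.2 hv.1 hadj)
  rw [abs_le] at hm ha hb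
  push_cast at hm ha hb
  have hma : m + 2 * k - a = 0 := by
    refine Int.eq_zero_of_abs_lt_dvd (m := q) ((ZMod.intCast_zmod_eq_zero_iff_dvd _ _).1 ?_)
      (abs_lt.2 ⟨by omega, by omega⟩)
    push_cast
    rw [← em, ← ea]
    ring
  have hmb : m - 2 * k - b = 0 := by
    refine Int.eq_zero_of_abs_lt_dvd (m := q) ((ZMod.intCast_zmod_eq_zero_iff_dvd _ _).1 ?_)
      (abs_lt.2 ⟨by omega, by omega⟩)
    push_cast
    rw [← em, ← eb]
    ring
  have hj : j = i + (m : ZMod q) := by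
    rw [← em]
    ring
  obtain rfl | rfl | rfl : m = -1 ∨ m = 0 ∨ m = 1 := by omega
  · exact Or.inl (by simpa [sub_eq_add_neg] using hj)
  · exact Or.inr (Or.inl (by simpa using hj))
  · exact Or.inr (Or.inr (by simpa using hj))
end

section
/- Every vertex of an equatorial graph with equator q lies on some isometric cycle of length q. -/
open SimpleGraph

section MooreBound

variable {V : Type*} {G : SimpleGraph V}

/-- Two neighbors of `x` that are no farther from `r` than `x` force a short cycle. -/
theorem girth_le_of_two_closer_neighbors (hG : G.Connected) {r x y z : V} (hxy : G.Adj x y)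
    (hxz : G.Adj x z) (hyz : y ≠ z) (hy : G.dist y r ≤ G.dist x r)
    (hz : G.dist z r ≤ G.dist x r) :
    G.girth ≤ G.dist y r + G.dist z r + 2 := by
  classical
  have notMem : ∀ {w : V} (p : G.Walk w r), G.Adj x w → p.length = G.dist w r →
      G.dist w r ≤ G.dist x r → x ∉ p.support := by
    intro w p hxw hp hw hx
    have h₁ := G.dist_le (p.dropUntil x hx)
    have h₂ := congrArg Walk.length (p.take_spec hx)
    have h₃ := G.dist_le (p.takeUntil x hx)
    have h₄ := hG.pos_dist_of_ne hxw.ne'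
    rw [Walk.length_append] at h₂
    lia
  obtain ⟨p, hp, hpl⟩ := hG.exists_path_of_dist y r
  obtain ⟨p', hp', hpl'⟩ := hG.exists_path_of_dist z r
  have hne : Walk.cons hxy p ≠ Walk.cons hxz p' := by
    intro h
    apply hyz
    simpa using congrArg (fun w => w.getVert 1) h
  obtain ⟨_, _, _, c, hc, hcl⟩ := Walk.IsPath.exists_isCycle_length_le_add_of_ne
    (hp.cons (notMem p hxy hpl hy)) (hp'.cons (notMem p' hxz hpl' hz)) hne
  have := girth_le_length hc
  simp only [Walk.length_cons] at hcl
  lia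

theorem exists_adj_dist_add_one_eq (hG : G.Connected) {r x : V} (hx : x ≠ r) :
    ∃ w, G.Adj x w ∧ G.dist w r + 1 = G.dist x r := by
  obtain ⟨p, hp⟩ := hG.exists_walk_length_eq_dist x r
  cases p with
  | nil => exact absurd rfl hx
  | @cons _ w _ h p =>
    refine ⟨w, h, ?_⟩
    have h₁ := G.dist_le p
    have h₂ := hG.dist_triangle (u := x) (v := w) (w := r)
    rw [dist_eq_one_iff_adj.mpr h] at h₂
    rw [Walk.length_cons] at hp
    lia

theorem dist_le_dist_add_one_of_adj (hG : G.Connected) {r x y : V} (h : G.Adj x y) :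
    G.dist y r ≤ G.dist x r + 1 := by
  have := hG.dist_triangle (u := y) (v := x) (w := r)
  rw [dist_eq_one_iff_adj.mpr h.symm] at this
  lia

open Classical in
/-- Within half the girth, all neighbors of `x` but at most one lie one step farther from `r`. -/
theorem minDegree_le_card_farther [Fintype V] (hG : G.Connected) {δ : ℕ}
    (hδ : ∀ v, δ ≤ ndeg G v) (r x : V) (hx : 2 * G.dist x r + 1 < G.girth) :
    δ - 1 ≤ Finset.card {y | G.Adj x y ∧ G.dist y r = G.dist x r + 1} := by
  have hδx : δ ≤ (Finset.univ.filter fun y => G.Adj x y).card := by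
    have := hδ x
    rwa [ndeg, Set.ncard_eq_toFinset_card',
      show (G.neighborSet x).toFinset = Finset.univ.filter fun y => G.Adj x y by
        ext; simp] at this
  have key : ∃ w, ∀ y, G.Adj x y → y ≠ w → G.dist y r = G.dist x r + 1 := by
    by_cases hxr : x = r
    · subst hxr
      refine ⟨x, fun y hy _ => ?_⟩
      simp [dist_eq_one_iff_adj.mpr hy.symm]
    · obtain ⟨w, hw, hwr⟩ := exists_adj_dist_add_one_eq hG hxr
      refine ⟨w, fun y hy hne => ?_⟩
      have h₁ := dist_le_dist_add_one_of_adj hG (r := r) hy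
      by_contra hcon
      have := girth_le_of_two_closer_neighbors hG (r := r) hy hw hne (by lia) (by lia)
      lia
  obtain ⟨w, hw⟩ := key
  calc δ - 1 ≤ (Finset.univ.filter fun y => G.Adj x y).card - 1 := by lia
    _ ≤ ((Finset.univ.filter fun y => G.Adj x y).erase w).card := Finset.pred_card_le_card_erase
    _ ≤ _ := by
      apply Finset.card_le_card
      intro y hy
      simp only [Finset.mem_erase, Finset.mem_filter, Finset.mem_univ, true_and] at hy ⊢
      exact ⟨hy.2, hw y hy.2 hy.1⟩

open Classical in
theorem card_mul_le_card_of_unique_adj {A B : Finset V} {d : ℕ}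
    (hA : ∀ x ∈ A, d ≤ {y ∈ B | G.Adj x y}.card)
    (hB : ∀ y ∈ B, ∀ x ∈ A, ∀ x' ∈ A, G.Adj x y → G.Adj x' y → x = x') :
    A.card * d ≤ B.card := by
  have := Finset.card_mul_le_card_mul (s := A) (t := B) (m := d) (n := 1) G.Adj hA
    (fun y hy => Finset.card_le_one.mpr fun x hx x' hx' => by
      simp only [Finset.bipartiteBelow, Finset.mem_filter] at hx hx'
      exact hB y hy x hx.1 x' hx'.1 hx.2 hx'.2)
  lia

open Classical in
theorem mul_pow_le_card_sphere [Fintype V] (hG : G.Connected) {δ : ℕ}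
    (hδ : ∀ v, δ ≤ ndeg G v) (r : V) (i : ℕ) (hi : 2 * (i + 1) < G.girth) :
    δ * (δ - 1) ^ i ≤ Finset.card {y | G.dist y r = i + 1} := by
  induction i with
  | zero =>
    have := hδ r
    rw [ndeg, Set.ncard_eq_toFinset_card'] at this
    simp only [pow_zero, mul_one]
    refine this.trans (Finset.card_le_card fun y hy => ?_)
    simp only [Set.mem_toFinset, mem_neighborSet] at hy
    simpa using hy.symm
  | succ i ih =>
    refine le_trans ?_ (card_mul_le_card_of_unique_adj (G := G)
      (A := {y | G.dist y r = i + 1}) (d := δ - 1) ?_ ?_)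
    · rw [pow_succ, ← mul_assoc]
      exact Nat.mul_le_mul_right _ (ih (by lia))
    · intro x hx
      simp only [Finset.mem_filter, Finset.mem_univ, true_and] at hx
      refine (minDegree_le_card_farther hG hδ r x (by lia)).trans (Finset.card_le_card ?_)
      intro y hy
      simp only [Finset.mem_filter, Finset.mem_univ, true_and] at hy ⊢
      exact ⟨by lia, hy.1⟩
    · intro y hy x hx x' hx' hxy hxy'
      simp only [Finset.mem_filter, Finset.mem_univ, true_and] at hx hx' hy
      by_contra hne
      have := girth_le_of_two_closer_neighbors hG (r := r) hxy.symm hxy'.symm hne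
        (by lia) (by lia)
      lia

open Classical in
theorem moore_le_card_disk [Fintype V] (hG : G.Connected) {δ : ℕ}
    (hδ : ∀ v, δ ≤ ndeg G v) (r : V) (k : ℕ) (hk : 2 * k < G.girth) :
    1 + δ * ∑ i ∈ Finset.range k, (δ - 1) ^ i ≤ Finset.card {y | G.dist y r ≤ k} := by
  induction k with
  | zero =>
    simp only [Finset.range_zero, Finset.sum_empty, mul_zero, add_zero, Nat.le_zero]
    exact Finset.card_pos.mpr ⟨r, by simp⟩
  | succ k ih =>
    rw [Finset.sum_range_succ, mul_add, ← add_assoc]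
    refine (add_le_add (ih (by lia)) (mul_pow_le_card_sphere hG hδ r k hk)).trans ?_
    rw [← Finset.card_union_of_disjoint]
    · refine Finset.card_le_card fun y hy => ?_
      simp only [Finset.mem_union, Finset.mem_filter, Finset.mem_univ, true_and] at hy ⊢
      lia
    · refine Finset.disjoint_filter.mpr fun y _ h₁ h₂ => ?_
      lia

open Classical in
/-- Lower bound for the sphere of radius `i` in the branch at `v` hanging off the edge `uv`. -/
theorem pow_le_card_branch [Fintype V] (hG : G.Connected) {δ : ℕ}
    (hδ : ∀ v, δ ≤ ndeg G v) {u v : V} (huv : G.Adj u v) (i : ℕ) (hi : 2 * i + 1 < G.girth) :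
    (δ - 1) ^ i ≤ Finset.card {y | G.dist y v = i ∧ G.dist y u = i + 1} := by
  induction i with
  | zero =>
    rw [pow_zero, Nat.one_le_iff_ne_zero, ← Nat.pos_iff_ne_zero, Finset.card_pos]
    exact ⟨v, by simpa using huv.symm⟩
  | succ i ih =>
    refine le_trans ?_ (card_mul_le_card_of_unique_adj (G := G)
      (A := {y | G.dist y v = i ∧ G.dist y u = i + 1}) (d := δ - 1) ?_ ?_)
    · rw [pow_succ]
      exact Nat.mul_le_mul_right _ (ih (by lia))
    · intro x hx
      simp only [Finset.mem_filter, Finset.mem_univ, true_and] at hx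
      refine (minDegree_le_card_farther hG hδ u x (by lia)).trans (Finset.card_le_card ?_)
      intro y hy
      simp only [Finset.mem_filter, Finset.mem_univ, true_and] at hy ⊢
      have h₁ := dist_le_dist_add_one_of_adj hG (r := v) hy.1
      have h₂ := hG.dist_triangle (u := y) (v := v) (w := u)
      rw [dist_eq_one_iff_adj.mpr huv.symm] at h₂
      exact ⟨⟨by lia, by lia⟩, hy.1⟩
    · intro y hy x hx x' hx' hxy hxy'
      simp only [Finset.mem_filter, Finset.mem_univ, true_and] at hx hx' hy
      by_contra hne
      have := girth_le_of_two_closer_neighbors hG (r := v) hxy.symm hxy'.symm hne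
        (by lia) (by lia)
      lia

open Classical in
theorem moore_le_card_edisk [Fintype V] (hG : G.Connected) {δ : ℕ} (hpos : 1 ≤ δ)
    (hδ : ∀ v, δ ≤ ndeg G v) {u v : V} (huv : G.Adj u v) (k : ℕ) (hk : 2 * k + 1 < G.girth) :
    2 + ∑ i ∈ Finset.Icc 1 k, 2 * (δ - 1) ^ i ≤ Finset.card {y | G.dist y u ≤ k ∨ G.dist y v ≤ k} := by
  have identity : 2 + ∑ i ∈ Finset.Icc 1 k, 2 * (δ - 1) ^ i =
      1 + δ * ∑ i ∈ Finset.range k, (δ - 1) ^ i + (δ - 1) ^ k := by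
    obtain ⟨d, rfl⟩ := Nat.exists_eq_add_of_le' hpos
    clear hk hδ hpos
    rw [Nat.add_sub_cancel]
    induction k with
    | zero => simp
    | succ k ih =>
      rw [Finset.sum_Icc_succ_top (by lia), Finset.sum_range_succ, ← add_assoc, ih]
      ring
  rw [identity]
  refine (add_le_add (moore_le_card_disk hG hδ u k (by lia))
    (pow_le_card_branch hG hδ huv k hk)).trans ?_
  rw [← Finset.card_union_of_disjoint]
  · refine Finset.card_le_card fun y hy => ?_
    simp only [Finset.mem_union, Finset.mem_filter, Finset.mem_univ, true_and] at hy ⊢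
    lia
  · refine Finset.disjoint_filter.mpr fun y _ h₁ h₂ => ?_
    lia

end MooreBound

section CycleDist

variable {q : ℕ}

theorem cycleDist_le_iff [NeZero q] {i j : ZMod q} {m : ℕ} :
    cycleDist i j ≤ m ↔ ∃ n : ℤ, n.natAbs ≤ m ∧ (n : ZMod q) = i - j := by
  unfold cycleDist
  constructor
  · intro h
    rcases min_le_iff.mp h with h | h
    · exact ⟨(i - j).val, by rwa [Int.natAbs_natCast], by simp⟩
    · exact ⟨-(j - i).val, by rwa [Int.natAbs_neg, Int.natAbs_natCast], by simp⟩
  · rintro ⟨n, hn, hnij⟩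
    refine le_trans ?_ hn
    rcases Int.natAbs_eq n with h | h
    · refine min_le_of_left_le ?_
      rw [h, Int.cast_natCast] at hnij
      rw [← hnij, ZMod.val_natCast]
      exact Nat.mod_le _ _
    · refine min_le_of_right_le ?_
      rw [h, Int.cast_neg, Int.cast_natCast] at hnij
      rw [← neg_sub i j, ← hnij, neg_neg, ZMod.val_natCast]
      exact Nat.mod_le _ _

theorem int_eq_of_zmod_cast_eq {a b : ℤ} (h : (a : ZMod q) = b) (hlt : (b - a).natAbs < q) :
    a = b := by
  rw [ZMod.intCast_eq_intCast_iff_dvd_sub] at h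
  have := Int.eq_zero_of_abs_lt_dvd h (by rw [Int.abs_eq_natAbs]; lia)
  lia

/-- A set of indices of small diameter lies on an arc starting at one of its elements. -/
theorem exists_arc_of_cycleDist_le [NeZero q] {k : ℕ} (hq : 6 * k < q) {S : Finset (ZMod q)}
    (hS : S.Nonempty) (hdiam : ∀ x ∈ S, ∀ y ∈ S, cycleDist x y ≤ 2 * k) :
    ∃ m ∈ S, ∀ x ∈ S, ∃ t : ℕ, t ≤ 2 * k ∧ x = m + t := by
  obtain ⟨x₀, hx₀⟩ := hS
  have hn : ∀ x, ∃ n : ℤ, x ∈ S → n.natAbs ≤ 2 * k ∧ (n : ZMod q) = x - x₀ := by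
    intro x
    by_cases hx : x ∈ S
    · obtain ⟨n, h⟩ := cycleDist_le_iff.mp (hdiam x hx x₀ hx₀)
      exact ⟨n, fun _ => h⟩
    · exact ⟨0, fun h => absurd h hx⟩
  choose n hn using hn
  obtain ⟨m, hm, hmin⟩ := S.exists_min_image n ⟨x₀, hx₀⟩
  refine ⟨m, hm, fun x hx => ?_⟩
  obtain ⟨d, hd, hdx⟩ := cycleDist_le_iff.mp (hdiam x hx m hm)
  have h₁ := hn x hx
  have h₂ := hn m hm
  have h₃ := hmin x hx
  have h₄ : d = n x - n m := by
    apply int_eq_of_zmod_cast_eq (q := q)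
    · rw [hdx, Int.cast_sub, h₁.2, h₂.2]; ring
    · lia
  refine ⟨d.toNat, by lia, ?_⟩
  have h₅ : ((d.toNat : ℤ) : ZMod q) = d := by rw [Int.toNat_of_nonneg (by lia)]
  rw [Int.cast_natCast] at h₅
  rw [h₅, hdx]; ring

theorem card_le_of_forall_eq_add [NeZero q] {J : Finset (ZMod q)} {m : ZMod q} {N : ℕ}
    (h : ∀ x ∈ J, ∃ t : ℕ, t < N ∧ x = m + t) : J.card ≤ N := by
  calc J.card ≤ ((Finset.range N).image fun t : ℕ => m + (t : ZMod q)).card := by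
        refine Finset.card_le_card fun x hx => ?_
        obtain ⟨t, ht, rfl⟩ := h x hx
        exact Finset.mem_image.mpr ⟨t, Finset.mem_range.mpr ht, rfl⟩
    _ ≤ _ := Finset.card_image_le.trans (by simp)

theorem card_small_diameter [NeZero q] {k : ℕ} (hq : 6 * k < q) {S : Finset (ZMod q)}
    (hdiam : ∀ x ∈ S, ∀ y ∈ S, cycleDist x y ≤ 2 * k) :
    S.card ≤ 2 * k + 1 ∧ ((¬ ∃ i : ZMod q, i - k ∈ S ∧ i + k ∈ S) → S.card < 2 * k + 1) := by
  rcases S.eq_empty_or_nonempty with rfl | hS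
  · simp
  obtain ⟨m, hm, harc⟩ := exists_arc_of_cycleDist_le hq hS hdiam
  constructor
  · refine card_le_of_forall_eq_add (m := m) fun x hx => ?_
    obtain ⟨t, ht, h⟩ := harc x hx
    exact ⟨t, by lia, h⟩
  · intro hno
    rw [Nat.lt_succ_iff]
    refine card_le_of_forall_eq_add (m := m) fun x hx => ?_
    obtain ⟨t, ht, h⟩ := harc x hx
    refine ⟨t, lt_of_le_of_ne ht ?_, h⟩
    rintro rfl
    refine hno ⟨m + k, by simpa using hm, ?_⟩
    rw [h] at hx
    convert hx using 1
    push_cast; ring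

open Classical in
/-- The analogue of `card_small_diameter` counting the edges `{i, i + 1}` that meet the set. -/
theorem card_edges_small_diameter [NeZero q] {k : ℕ} (hq : 6 * k < q) {S : Finset (ZMod q)}
    (hdiam : ∀ x ∈ S, ∀ y ∈ S, cycleDist x y ≤ 2 * k) :
    Finset.card {i | i ∈ S ∨ i + 1 ∈ S} ≤ 2 * k + 2 ∧
      ((¬ ∃ i : ZMod q, i - k ∈ S ∧ i + k ∈ S) →
        Finset.card {i | i ∈ S ∨ i + 1 ∈ S} < 2 * k + 2) := by
  rcases S.eq_empty_or_nonempty with rfl | hS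
  · simp
  obtain ⟨m, hm, harc⟩ := exists_arc_of_cycleDist_le hq hS hdiam
  have edges : ∀ N : ℕ, (∀ x ∈ S, ∃ t : ℕ, t < N ∧ x = m + t) →
      Finset.card {i | i ∈ S ∨ i + 1 ∈ S} ≤ N + 1 := by
    intro N hN
    refine card_le_of_forall_eq_add (m := m - 1) fun x hx => ?_
    simp only [Finset.mem_filter, Finset.mem_univ, true_and] at hx
    rcases hx with hx | hx
    · obtain ⟨t, ht, h⟩ := hN x hx
      exact ⟨t + 1, by lia, by rw [h]; push_cast; ring⟩
    · obtain ⟨t, ht, h⟩ := hN _ hx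
      exact ⟨t, by lia, by rw [eq_sub_of_add_eq h]; ring⟩
  constructor
  · refine edges (2 * k + 1) fun x hx => ?_
    obtain ⟨t, ht, h⟩ := harc x hx
    exact ⟨t, by lia, h⟩
  · intro hno
    rw [Nat.lt_succ_iff]
    refine edges (2 * k) fun x hx => ?_
    obtain ⟨t, ht, h⟩ := harc x hx
    refine ⟨t, lt_of_le_of_ne ht ?_, h⟩
    rintro rfl
    refine hno ⟨m + k, by simpa using hm, ?_⟩
    rw [h] at hx
    convert hx using 1
    push_cast; ring

end CycleDist

section Levels

variable {V : Type*} {G : SimpleGraph V} {k q : ℕ} {f : ZMod q → V}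

open Classical in
/-- In an equatorial graph the parts `Lpart G k f i` cover all vertices. -/
theorem exists_mem_Lpart {δ g : ℕ} (hG : IsEquatorial G δ g q) (hf : IsIsoCycle G q f) (v : V) :
    ∃ i, v ∈ Lpart G ((g + 1) / 2 - 1) f i := by
  obtain ⟨hfin, hconn, hg, ⟨hδ, w, hw⟩, -, hq, hcard⟩ := hG
  have : NeZero q := ⟨by lia⟩
  have := Fintype.ofFinite V
  rw [Nat.card_eq_fintype_card] at hcard
  have hcyc : ¬ G.IsAcyclic := by
    rw [← girth_eq_zero, hg]
    rintro rfl
    simp [mooreBound] at hcard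
    lia
  have hg3 := three_le_girth hcyc
  rw [hg] at hg3
  set k := (g + 1) / 2 - 1 with hk
  let S : V → Finset (ZMod q) := fun x => {i | G.dist x (f i) ≤ k}
  have hS : ∀ x, ∀ i ∈ S x, ∀ j ∈ S x, cycleDist i j ≤ 2 * k := by
    intro x i hi j hj
    simp only [S, Finset.mem_filter, Finset.mem_univ, true_and] at hi hj
    have := hconn.dist_triangle (u := f i) (v := x) (w := f j)
    rw [hf.2, G.dist_comm (u := f i)] at this
    lia
  by_contra hv
  have hvS : ¬ ∃ i : ZMod q, i - k ∈ S v ∧ i + k ∈ S v := by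
    rintro ⟨i, h₁, h₂⟩
    simp only [S, Finset.mem_filter, Finset.mem_univ, true_and] at h₁ h₂
    refine hv ⟨i, ?_, ?_⟩
    · rwa [disk, Set.mem_ofPred_eq, SimpleGraph.dist_comm]
    · rwa [disk, Set.mem_ofPred_eq, SimpleGraph.dist_comm]
  -- Double counting: a family of large disks covering each vertex at most `g` times.
  have count : ∀ J : V → Finset (ZMod q), (∀ x, (J x).card ≤ g) → (J v).card < g →
      (∀ i, mooreBound δ g ≤ Finset.card {x | i ∈ J x}) → False := by
    intro J hJ hJv hM
    have h₁ : ∑ x, (J x).card < ∑ _x : V, g :=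
      Finset.sum_lt_sum (fun x _ => hJ x) ⟨v, Finset.mem_univ v, hJv⟩
    have h₂ : ∑ x, (J x).card = ∑ i, Finset.card {x | i ∈ J x} := by
      have := Finset.sum_card_bipartiteAbove_eq_sum_card_bipartiteBelow
        (s := (Finset.univ : Finset V)) (t := (Finset.univ : Finset (ZMod q)))
        (fun x i => i ∈ J x)
      simpa [Finset.bipartiteAbove, Finset.bipartiteBelow] using this
    have h₃ : ∑ _i : ZMod q, mooreBound δ g ≤ ∑ i, Finset.card {x | i ∈ J x} :=
      Finset.sum_le_sum fun i _ => hM i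
    simp only [Finset.sum_const, Finset.card_univ, ZMod.card, smul_eq_mul] at h₁ h₃
    lia
  rcases Nat.even_or_odd g with heven | hodd
  · have hgk : g = 2 * k + 2 := by obtain ⟨m, rfl⟩ := heven; lia
    have hadj : ∀ i, G.Adj (f i) (f (i + 1)) := by
      intro i
      have h₁ : G.dist (f i) (f (i + 1)) ≤ 1 := by
        rw [hf.2, cycleDist_le_iff]
        exact ⟨-1, by simp, by simp⟩
      have h₂ : f i ≠ f (i + 1) := by
        intro h
        have h₃ : cycleDist i (i + 1) ≤ 0 := by rw [← hf.2, h, SimpleGraph.dist_self]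
        obtain ⟨n, hn, hn'⟩ := cycleDist_le_iff.mp h₃
        have h₄ : n = -1 := int_eq_of_zmod_cast_eq (q := q) (by rw [hn']; simp) (by lia)
        lia
      have := hconn.pos_dist_of_ne h₂
      exact dist_eq_one_iff_adj.mp (by lia)
    have hpos : 1 ≤ δ := by
      have : Nontrivial V := ⟨⟨_, _, (hadj 0).ne⟩⟩
      obtain ⟨y, hy⟩ := hconn.preconnected.exists_adj_of_nontrivial w
      rw [← hw, ndeg, Nat.one_le_iff_ne_zero, ← Nat.pos_iff_ne_zero, Set.ncard_pos]
      exact ⟨y, hy⟩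
    refine count (fun x => {i | i ∈ S x ∨ i + 1 ∈ S x}) (fun x => ?_) ?_ fun i => ?_
    · rw [hgk]
      exact (card_edges_small_diameter (by lia) (hS x)).1
    · rw [hgk]
      exact (card_edges_small_diameter (by lia) (hS v)).2 hvS
    · have := moore_le_card_edisk hconn hpos hδ (hadj i) k (by lia)
      rw [mooreBound, if_neg (Nat.not_odd_iff_even.mpr heven)]
      simpa [S] using this
  · have hgk : g = 2 * k + 1 := by obtain ⟨m, rfl⟩ := hodd; lia
    refine count S (fun x => ?_) ?_ fun i => ?_
    · rw [hgk]
      exact (card_small_diameter (by lia) (hS x)).1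
    · rw [hgk]
      exact (card_small_diameter (by lia) (hS v)).2 hvS
    · have := moore_le_card_disk hconn hδ (f i) k (by lia)
      rw [mooreBound, if_pos hodd]
      simpa [S] using this

/-- If the parts cover the graph, then assigning to each vertex the index of a part containing it
does not increase distances. -/
theorem cycleDist_level_le_dist [NeZero q] (hG : G.Connected) (hf : IsIsoCycle G q f)
    (hq : 6 * k + 3 < q) {ℓ : V → ZMod q} (hℓ : ∀ x, x ∈ Lpart G k f (ℓ x)) (x y : V) :
    cycleDist (ℓ x) (ℓ y) ≤ G.dist x y := by
  have hadj : ∀ x y, G.Adj x y → cycleDist (ℓ x) (ℓ y) ≤ 1 := by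
    intro x y hxy
    have tri : ∀ i j, G.dist (f i) x ≤ k → G.dist (f j) y ≤ k → cycleDist i j ≤ 2 * k + 1 := by
      intro i j hi hj
      have h₁ := hG.dist_triangle (u := f i) (v := x) (w := f j)
      have h₂ := hG.dist_triangle (u := x) (v := y) (w := f j)
      rw [dist_eq_one_iff_adj.mpr hxy, G.dist_comm (u := y)] at h₂
      rw [hf.2] at h₁
      lia
    obtain ⟨hx₁, hx₂⟩ := hℓ x
    obtain ⟨hy₁, hy₂⟩ := hℓ y
    obtain ⟨a, ha, ha'⟩ := cycleDist_le_iff.mp (tri _ _ hx₁ hy₁)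
    obtain ⟨b, hb, hb'⟩ := cycleDist_le_iff.mp (tri _ _ hx₁ hy₂)
    obtain ⟨c, hc, hc'⟩ := cycleDist_le_iff.mp (tri _ _ hx₂ hy₁)
    have hab : b = a - 2 * k := by
      apply int_eq_of_zmod_cast_eq (q := q)
      · push_cast; rw [ha', hb']; ring
      · lia
    have hac : c = a + 2 * k := by
      apply int_eq_of_zmod_cast_eq (q := q)
      · push_cast; rw [ha', hc']; ring
      · lia
    refine cycleDist_le_iff.mpr ⟨a, by lia, ?_⟩
    rw [ha']; ring
  obtain ⟨p, hp⟩ := hG.exists_walk_length_eq_dist x y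
  rw [← hp]
  clear hp
  induction p with
  | nil => simp [cycleDist]
  | @cons u w z h p ih =>
    have h₁ := hG.dist_triangle (u := f (ℓ u)) (v := f (ℓ w)) (w := f (ℓ z))
    rw [hf.2, hf.2, hf.2] at h₁
    have h₂ := hadj _ _ h
    rw [Walk.length_cons]
    lia

theorem level_apply_eq [NeZero q] (hf : IsIsoCycle G q f) (hq : 6 * k + 3 < q) {j i : ZMod q}
    (h : f j ∈ Lpart G k f i) : i = j := by
  obtain ⟨h₁, h₂⟩ := h
  rw [disk, Set.mem_ofPred_eq, hf.2] at h₁ h₂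
  obtain ⟨a, ha, ha'⟩ := cycleDist_le_iff.mp h₁
  obtain ⟨b, hb, hb'⟩ := cycleDist_le_iff.mp h₂
  have hab : b = a + 2 * k := by
    apply int_eq_of_zmod_cast_eq (q := q)
    · push_cast; rw [ha', hb']; ring
    · lia
  have hak : a = -k := by lia
  rw [hak] at ha'
  push_cast at ha'
  linear_combination -ha'

/-- A closed walk of length `q` visiting the levels in cyclic order is an isometric cycle. -/
theorem isIsoCycle_of_level (hG : G.Connected) [NeZero q] (hq : 3 ≤ q) {ℓ : V → ZMod q}
    (hℓ : ∀ x y, cycleDist (ℓ x) (ℓ y) ≤ G.dist x y) {F : ZMod q → V}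
    (hF : ∀ j, ℓ (F j) = j) (hstep : ∀ j, G.dist (F j) (F (j + 1)) ≤ 1) : IsIsoCycle G q F := by
  have hle : ∀ (n : ℕ) j, G.dist (F j) (F (j + n)) ≤ n := by
    intro n j
    induction n with
    | zero => simp
    | succ n ih =>
      have h₁ := hG.dist_triangle (u := F j) (v := F (j + n)) (w := F (j + (n + 1 : ℕ)))
      have h₂ := hstep (j + n)
      rw [Nat.cast_succ, ← add_assoc] at h₁ ⊢
      lia
  have hval : ∀ i j, G.dist (F i) (F j) ≤ (j - i).val := by
    intro i j
    simpa using hle (j - i).val i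
  refine ⟨hq, fun i j => le_antisymm (le_min ?_ (hval i j)) ?_⟩
  · rw [SimpleGraph.dist_comm]
    exact hval j i
  · simpa [hF] using hℓ (F i) (F j)

/-- The segment of an isometric cycle between the indices `s` and `s + 2k` can be rerouted along
any walk of length `2k`, provided that the parts cover the graph. -/
theorem isIsoCycle_reroute [NeZero q] (hG : G.Connected) (hf : IsIsoCycle G q f)
    (hq : 6 * k + 3 < q) (hcover : ∀ x, ∃ i, x ∈ Lpart G k f i) {s : ZMod q}
    (p : G.Walk (f s) (f (s + (2 * k : ℕ)))) (hp : p.length = 2 * k) :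
    IsIsoCycle G q fun j =>
      if (j - s).val ≤ 2 * k then p.getVert (j - s).val else f j := by
  choose ℓ hℓ using hcover
  have hlip := cycleDist_level_le_dist hG hf hq hℓ
  have hℓf : ∀ j, ℓ (f j) = j := fun j => level_apply_eq hf hq (hℓ (f j))
  set F : ZMod q → V := fun j =>
    if (j - s).val ≤ 2 * k then p.getVert (j - s).val else f j with hFdef
  have hF : ∀ t : ℕ, t < q → F (s + t) = if t ≤ 2 * k then p.getVert t else f (s + t) := by
    intro t ht
    simp only [hFdef, add_sub_cancel_left, ZMod.val_natCast_of_lt ht]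
  have hF_end : ∀ t : ℕ, 2 * k ≤ t → t ≤ q → F (s + t) = f (s + t) := by
    intro t ht htq
    rcases htq.lt_or_eq with h | rfl
    · rw [hF t h]
      split_ifs with h'
      · obtain rfl : t = 2 * k := by lia
        simpa [hp] using p.getVert_length
      · rfl
    · have := hF 0 (by lia)
      simpa using this
  have hcast : ∀ j : ZMod q, ∃ t : ℕ, t < q ∧ j = s + t :=
    fun j => ⟨(j - s).val, ZMod.val_lt _, by simp⟩
  refine isIsoCycle_of_level hG hf.1 hlip ?_ ?_
  · intro j
    obtain ⟨t, ht, rfl⟩ := hcast j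
    rw [hF t ht]
    split_ifs with h
    · have h₁ : G.dist (p.getVert t) (f s) ≤ t := by
        rw [SimpleGraph.dist_comm]
        refine (G.dist_le (p.take t)).trans ?_
        simp
      have h₂ : G.dist (p.getVert t) (f (s + (2 * k : ℕ))) ≤ 2 * k - t := by
        refine (G.dist_le (p.drop t)).trans ?_
        simp [hp]
      have h₃ := (hlip _ _).trans h₁
      have h₄ := (hlip _ _).trans h₂
      rw [hℓf] at h₃ h₄
      obtain ⟨a, ha, ha'⟩ := cycleDist_le_iff.mp h₃
      obtain ⟨b, hb, hb'⟩ := cycleDist_le_iff.mp h₄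
      have hab : b = a - 2 * k := by
        apply int_eq_of_zmod_cast_eq (q := q)
        · push_cast at hb' ⊢; rw [ha', hb']; ring
        · lia
      have hat : a = t := by lia
      rw [hat, Int.cast_natCast] at ha'
      rw [ha']; ring
    · exact hℓf _
  · intro j
    obtain ⟨t, ht, rfl⟩ := hcast j
    rw [add_assoc, ← Nat.cast_succ]
    by_cases h : t < 2 * k
    · rw [hF t ht, hF (t + 1) (by lia), if_pos (by lia), if_pos (by lia)]
      exact (dist_eq_one_iff_adj.mpr (p.adj_getVert_succ (by lia))).le
    · rw [hF_end t (by lia) (by lia), hF_end (t + 1) (by lia) (by lia), hf.2, cycleDist_le_iff]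
      exact ⟨-1, by simp, by simp⟩

end Levels

/-- Proposition 5.6: every vertex of an equatorial graph lies on some isometric `q`-cycle. -/
theorem stmt_11 {V : Type*} (G : SimpleGraph V) (δ g q : ℕ)
    (hG : IsEquatorial G δ g q) (v : V) :
    ∃ f : ZMod q → V, IsIsoCycle G q f ∧ ∃ i : ZMod q, f i = v := by
  obtain ⟨-, hconn, -, -, ⟨hequator, -⟩, hq, -⟩ := id hG
  have : NeZero q := ⟨by lia⟩
  obtain ⟨f, hf⟩ : HasIsoCycle G q := hequator.resolve_right fun h => by lia
  have hcover := exists_mem_Lpart hG hf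
  set k := (g + 1) / 2 - 1
  obtain ⟨i, hi₁, hi₂⟩ := hcover v
  have hend : i + (k : ZMod q) = i - k + (2 * k : ℕ) := by push_cast; ring
  rw [hend] at hi₂
  simp only [disk, Set.mem_ofPred_eq] at hi₁ hi₂
  rw [SimpleGraph.dist_comm] at hi₂
  have htri := hconn.dist_triangle (u := f (i - k)) (v := v) (w := f (i - k + (2 * k : ℕ)))
  rw [hf.2] at htri
  obtain ⟨n, hn, hn'⟩ := cycleDist_le_iff.mp htri
  have hnk : n = -(2 * k) := by
    apply int_eq_of_zmod_cast_eq (q := q)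
    · rw [hn']; push_cast; ring
    · lia
  obtain ⟨p₁, hp₁⟩ := hconn.exists_walk_length_eq_dist (f (i - k)) v
  obtain ⟨p₂, hp₂⟩ := hconn.exists_walk_length_eq_dist v (f (i - k + (2 * k : ℕ)))
  refine ⟨_, isIsoCycle_reroute hconn hf hq hcover (p₁.append p₂) ?_, i, ?_⟩
  · rw [Walk.length_append]
    lia
  · have hval : (i - (i - (k : ZMod q))).val = k := by
      rw [sub_sub_cancel, ZMod.val_natCast_of_lt (by lia)]
    have hk : p₁.length = k := by lia
    simp only [hval]
    rw [if_pos (by lia), Walk.getVert_append, if_neg (by lia), hk]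
    simp
end
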